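/- arXiv:1507.01104 — 3 statements merged into one kernel-verified Lean document; each statement's English description precedes it below -/
import Mathlib

section
/- Let ν > 0. With the convention α_{ν,0} = 0, for every n ≥ 1 the derivative d_ν' of the Dini function d_ν has exactly one zero in the open interval (α_{ν,n-1}, α_{ν,n}). -/
open Real Set

/-- Bessel function of the first kind `J_ν(x)` (series definition, intended for `x > 0`). -/
noncomputable def besselJ (ν x : ℝ) : ℝ :=
  ∑' n : ℕ, (-1 : ℝ) ^ n * (x / 2) ^ (ν + 2 * (n : ℝ)) /
    ((n.factorial : ℝ) * Real.Gamma (ν + n + 1))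

/-- Modified Bessel function of the first kind `I_ν(x)` (series definition, for `x > 0`). -/
noncomputable def besselI (ν x : ℝ) : ℝ :=
  ∑' n : ℕ, (x / 2) ^ (ν + 2 * (n : ℝ)) /
    ((n.factorial : ℝ) * Real.Gamma (ν + n + 1))

/-- The cross-product `W_ν(x) = J_{ν+1}(x) I_ν(x) + J_ν(x) I_{ν+1}(x)`. -/
noncomputable def crossW (ν x : ℝ) : ℝ :=
  besselJ (ν + 1) x * besselI ν x + besselJ ν x * besselI (ν + 1) x

/-- The normalized cross-product `𝒲_ν`, an even entire function of `x`. -/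
noncomputable def Wcal (ν x : ℝ) : ℝ :=
  ∑' n : ℕ, (-1 : ℝ) ^ n * (Real.Gamma (ν + 1) * Real.Gamma (ν + 2)) * x ^ (4 * n) /
    ((2 : ℝ) ^ (4 * n) * (n.factorial : ℝ) * Real.Gamma (ν + n + 1) * Real.Gamma (ν + 2 * n + 2))

/-- The normalized Dini function `𝒟_ν`. -/
noncomputable def Dcal (ν x : ℝ) : ℝ :=
  ∑' n : ℕ, (-1 : ℝ) ^ n * (2 * (n : ℝ) + 1) * Real.Gamma (ν + 1) * x ^ (2 * n) /
    ((2 : ℝ) ^ (2 * n) * (n.factorial : ℝ) * Real.Gamma (ν + n + 1))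

/-- The normalized modified Dini function `λ_ν`. -/
noncomputable def lamDini (ν x : ℝ) : ℝ :=
  ∑' n : ℕ, (2 * (n : ℝ) + 1) * Real.Gamma (ν + 1) * x ^ (2 * n) /
    ((2 : ℝ) ^ (2 * n) * (n.factorial : ℝ) * Real.Gamma (ν + n + 1))

/-- The normalized Bessel function `𝒥_ν`. -/
noncomputable def Jcal (ν x : ℝ) : ℝ :=
  ∑' n : ℕ, (-1 : ℝ) ^ n * Real.Gamma (ν + 1) * x ^ (2 * n) /
    ((2 : ℝ) ^ (2 * n) * (n.factorial : ℝ) * Real.Gamma (ν + n + 1))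

/-- The normalized modified Bessel function `𝓘_ν`. -/
noncomputable def Ical (ν x : ℝ) : ℝ :=
  ∑' n : ℕ, Real.Gamma (ν + 1) * x ^ (2 * n) /
    ((2 : ℝ) ^ (2 * n) * (n.factorial : ℝ) * Real.Gamma (ν + n + 1))

/-- A function is absolutely monotonic on a set if it is infinitely differentiable there and
all of its (iterated) derivatives are nonnegative there. -/
def AbsolutelyMonotonicOn (f : ℝ → ℝ) (s : Set ℝ) : Prop :=
  ContDiffOn ℝ (⊤ : ℕ∞) f s ∧ ∀ (k : ℕ), ∀ x ∈ s, 0 ≤ iteratedDerivWithin k f s x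

/-- The Dini function `d_ν(x) = J_ν(x) - x J_{ν+1}(x)`. -/
noncomputable def dini (ν x : ℝ) : ℝ := besselJ ν x - x * besselJ (ν + 1) x

open Polynomial in
/-- real polynomials, all of whose complex zeros are positive reals -/
def PosRooted (Q : ℝ[X]) : Prop :=
  ∃ c : ℝ, c ≠ 0 ∧ ∃ m : Multiset ℝ, (∀ r ∈ m, 0 < r) ∧ Q = C c * (m.map (fun r => X - C r)).prod

open Polynomial in
theorem logderiv_aux (m : Multiset ℝ) (hm : ∀ r ∈ m, 0 < r) (z : ℂ)
    (hz : ∀ r ∈ m, z ≠ (r : ℂ)) :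
    ∃ S : ℂ, aeval z (derivative (m.map (fun r => X - C r)).prod) =
        aeval z (m.map (fun r => X - C r)).prod * S ∧
      aeval z (m.map (fun r => X - C r)).prod ≠ 0 ∧
      (∃ K : ℝ, 0 ≤ K ∧ S.im = - z.im * K) ∧ (z.im = 0 → z.re < 0 → S.re ≤ 0) := by
  induction m using Multiset.induction_on with
  | empty => exact ⟨0, by simp, by simp, ⟨0, by simp⟩, by simp⟩
  | cons r m ih =>
    obtain ⟨S, h1, h2, ⟨K, hK, h3⟩, h4⟩ := ih (fun r hr => hm r (Multiset.mem_cons_of_mem hr))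
      (fun r hr => hz r (Multiset.mem_cons_of_mem hr))
    have hr := hz r (Multiset.mem_cons_self r m)
    have hr0 := hm r (Multiset.mem_cons_self r m)
    have hne : z - (r : ℂ) ≠ 0 := sub_ne_zero.mpr hr
    refine ⟨S + (z - r)⁻¹, ?_, ?_, ⟨K + (Complex.normSq (z - r))⁻¹, ?_, ?_⟩, ?_⟩
    · simp only [Multiset.map_cons, Multiset.prod_cons, derivative_mul, map_add, map_mul, h1]
      simp
      field_simp
      ring
    · simp only [Multiset.map_cons, Multiset.prod_cons, map_mul]
      refine mul_ne_zero ?_ h2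
      simpa using hne
    · have := Complex.normSq_nonneg (z - r)
      positivity
    · simp [Complex.inv_im, h3]
      ring
    · intro hi hre
      have := h4 hi hre
      have h5 : ((z - r)⁻¹).re ≤ 0 := by
        rw [Complex.inv_re]
        apply div_nonpos_of_nonpos_of_nonneg
        · simp; linarith
        · exact Complex.normSq_nonneg _
      simp only [Complex.add_re]
      linarith

open Polynomial in
theorem PosRooted.of_roots (P : ℝ[X]) (hP : P ≠ 0)
    (h : ∀ z : ℂ, aeval z P = 0 → z.im = 0 ∧ 0 < z.re) : PosRooted P := by
  have hs : (P.map Complex.ofRealHom).Splits := IsAlgClosed.splits _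
  have h0 : P.map Complex.ofRealHom ≠ 0 := (Polynomial.map_ne_zero_iff Complex.ofRealHom.injective).2 hP
  have hroots : ∀ z ∈ (P.map Complex.ofRealHom).roots, z.im = 0 ∧ 0 < z.re := by
    intro z hz
    apply h
    rw [mem_roots h0, IsRoot, eval_map] at hz
    exact hz
  refine ⟨P.leadingCoeff, leadingCoeff_ne_zero.2 hP,
    (P.map Complex.ofRealHom).roots.map Complex.re, ?_, ?_⟩
  · intro r hr
    obtain ⟨z, hz, rfl⟩ := Multiset.mem_map.1 hr
    exact (hroots z hz).2
  · apply Polynomial.map_injective Complex.ofRealHom Complex.ofRealHom.injective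
    conv_lhs => rw [hs.eq_prod_roots]
    rw [Polynomial.map_mul, leadingCoeff_map, Polynomial.map_C, Polynomial.map_multiset_prod]
    congr 2
    rw [Multiset.map_map, Multiset.map_map]
    apply Multiset.map_congr rfl
    intro z hz
    have : ((z.re : ℝ) : ℂ) = z := Complex.ext rfl (by simp [(hroots z hz).1])
    simp [this]

open Polynomial in
theorem PosRooted.step {Q : ℝ[X]} (hQ : PosRooted Q) (a c : ℝ) (ha : 0 < a) (hc : 0 ≤ c) :
    PosRooted (X * derivative Q + (C a - C c * X) * Q) := by
  obtain ⟨k, hk, m, hm, rfl⟩ := hQ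
  have key : ∀ z : ℂ, aeval z (X * derivative (C k * (m.map (fun r => X - C r)).prod) +
      (C a - C c * X) * (C k * (m.map (fun r => X - C r)).prod)) = 0 → z.im = 0 ∧ 0 < z.re := by
    intro z hz
    by_cases hzm : ∀ r ∈ m, z ≠ (r : ℂ)
    · obtain ⟨S, h1, h2, ⟨K, hK, h3⟩, h4⟩ := logderiv_aux m hm z hzm
      have hk' : (k : ℂ) ≠ 0 := by exact_mod_cast hk
      have e : z * S + a - c * z = 0 := by
        simp only [derivative_C_mul, map_add, map_mul, map_sub, h1, aeval_X, aeval_C] at hz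
        have : (k : ℂ) * (aeval z) (m.map (fun r => X - C r)).prod * (z * S + a - c * z) = 0 := by
          rw [← hz]
          simp only [Complex.coe_algebraMap]
          ring
        exact (mul_eq_zero.1 this).resolve_left (mul_ne_zero hk' h2)
      have hz0 : z ≠ 0 := by
        rintro rfl
        simp at e
        exact ha.ne' e
      have e2 : S + a * z⁻¹ - c = 0 := by
        have : z * (S + a * z⁻¹ - c) = 0 := by
          rw [← e]; field_simp
        exact (mul_eq_zero.1 this).resolve_left hz0
      have hn : 0 < Complex.normSq z := Complex.normSq_pos.2 hz0
      have him : z.im = 0 := by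
        have := congrArg Complex.im e2
        simp [h3, Complex.inv_im] at this
        have h5 : z.im * (K + a / Complex.normSq z) = 0 := by
          rw [← neg_eq_zero, ← this]; ring
        have : 0 < K + a / Complex.normSq z := by positivity
        exact (mul_eq_zero.1 h5).resolve_right this.ne'
      refine ⟨him, ?_⟩
      by_contra hneg
      have hre : z.re < 0 := by
        rcases lt_or_eq_of_le (not_lt.1 hneg) with h | h
        · exact h
        · exact absurd (Complex.ext h him) hz0
      have h6 := h4 him hre
      have := congrArg Complex.re e2
      simp [Complex.inv_re] at this
      have h7 : z.re / Complex.normSq z < 0 := div_neg_of_neg_of_pos hre hn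
      nlinarith
    · push Not at hzm
      obtain ⟨r, hr, rfl⟩ := hzm
      simpa using hm r hr
  apply PosRooted.of_roots _ _ key
  intro h0
  have := key 0 (by rw [h0]; simp)
  simp at this

open Polynomial in
theorem PosRooted.laguerre {Q : ℝ[X]} (hQ : PosRooted Q) (x : ℝ) (hx : 0 ≤ x) :
    Q.eval x * (X * derivative (X * derivative Q)).eval x - ((X * derivative Q).eval x) ^ 2 ≤ 0 := by
  obtain ⟨k, hk, m, hm, rfl⟩ := hQ
  have key : ∀ m : Multiset ℝ, (∀ r ∈ m, 0 < r) → ∀ Q, Q = (m.map (fun r => X - C r)).prod →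
    Q.eval x * (X * derivative (X * derivative Q)).eval x - ((X * derivative Q).eval x) ^ 2 ≤ 0 := by
    intro m hm
    induction m using Multiset.induction_on with
    | empty => rintro _ rfl; simp
    | cons r m ih =>
      rintro _ rfl
      have h1 := ih (fun r hr => hm r (Multiset.mem_cons_of_mem hr)) _ rfl
      have hr0 := hm r (Multiset.mem_cons_self r m)
      rw [Multiset.map_cons, Multiset.prod_cons]
      generalize (m.map (fun r => X - C r)).prod = R at *
      simp at h1 ⊢
      have : 0 ≤ r * x * (eval x R) ^ 2 := by positivity
      nlinarith [mul_nonneg (sq_nonneg (x - r)) (sub_nonneg.2 h1)]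
  have h1 := key m hm _ rfl
  generalize (m.map (fun r => X - C r)).prod = R at *
  simp at h1 ⊢
  nlinarith [mul_nonneg (sq_nonneg k) (sub_nonneg.2 h1)]

open Polynomial in
noncomputable def lagP : ℕ → ℝ → ℝ[X]
  | 0, a => C (1 / Real.Gamma (a + 1))
  | N + 1, a => X * derivative (lagP N (a + 1)) + (C (a + 1) - C 1 * X) * lagP N (a + 1)

theorem lagP_posRooted (N : ℕ) : ∀ a : ℝ, 0 < a → PosRooted (lagP N a) := by
  induction N with
  | zero =>
    intro a ha
    have : 0 < Real.Gamma (a + 1) := Real.Gamma_pos_of_pos (by linarith)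
    exact ⟨1 / Real.Gamma (a + 1), by positivity, 0, by simp, by simp [lagP]⟩
  | succ N ih =>
    intro a ha
    exact (ih (a + 1) (by linarith)).step (a + 1) 1 (by linarith) zero_le_one

theorem coeff_theta (Q : Polynomial ℝ) (n : ℕ) :
    (Polynomial.X * Polynomial.derivative Q).coeff n = n * Q.coeff n := by
  cases n with
  | zero => simp
  | succ n => rw [Polynomial.coeff_X_mul, Polynomial.coeff_derivative]; push_cast; ring

theorem coeff_lin (Q : Polynomial ℝ) (a c : ℝ) (n : ℕ) :
    ((Polynomial.C a - Polynomial.C c * Polynomial.X) * Q).coeff (n + 1)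
      = a * Q.coeff (n + 1) - c * Q.coeff n := by
  rw [sub_mul, Polynomial.coeff_sub, Polynomial.coeff_C_mul, mul_assoc, Polynomial.coeff_C_mul,
    Polynomial.coeff_X_mul]

theorem lagP_coeff (N : ℕ) : ∀ a : ℝ, 0 < a → ∀ n, (lagP N a).coeff n =
    (-1) ^ n * (N.choose n) / Real.Gamma (a + n + 1) := by
  induction N with
  | zero =>
    intro a ha n
    cases n with
    | zero => simp [lagP]
    | succ n => simp [lagP]
  | succ N ih =>
    intro a ha n
    have hG : Real.Gamma (a + 1 + n + 1) = (a + 1 + n) * Real.Gamma (a + n + 1) := by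
      rw [Real.Gamma_add_one (by positivity)]; ring_nf
    have hG0 : 0 < Real.Gamma (a + n + 1) := Real.Gamma_pos_of_pos (by positivity)
    have h0 : 0 < a + 1 + (n : ℝ) := by positivity
    rw [lagP, Polynomial.coeff_add, coeff_theta]
    cases n with
    | zero =>
      rw [sub_mul, Polynomial.coeff_sub, Polynomial.coeff_C_mul, mul_assoc, Polynomial.coeff_C_mul,
        Polynomial.mul_coeff_zero, Polynomial.coeff_X_zero, ih (a + 1) (by linarith), hG]
      simp at *
      field_simp
    | succ n =>
      rw [coeff_lin, ih (a + 1) (by linarith), ih (a + 1) (by linarith), hG, Nat.choose_succ_succ]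
      have : a + 1 + (n : ℝ) + 1 = a + ((n + 1 : ℕ) : ℝ) + 1 := by push_cast; ring
      rw [this]
      push_cast at *
      field_simp
      ring

/-- coefficients -/
noncomputable def bco (ν : ℝ) (k n : ℕ) : ℝ :=
  (n : ℝ) ^ k * (n + 1 / 2) * (-1) ^ n / Real.Gamma (ν + n + 1) / n.factorial

noncomputable def ser (b : ℕ → ℝ) (t : ℝ) : ℝ := ∑' n, b n * t ^ n

def Ent (b : ℕ → ℝ) : Prop := ∀ r : ℝ, 0 ≤ r → Summable (fun n => |b n| * r ^ n)

theorem Gamma_lower (ν : ℝ) (hν : 0 < ν) (n : ℕ) :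
    Real.Gamma (ν + 1) ≤ Real.Gamma (ν + n + 1) := by
  induction n with
  | zero => simp
  | succ n ih =>
    have : Real.Gamma (ν + (n + 1 : ℕ) + 1) = (ν + n + 1) * Real.Gamma (ν + n + 1) := by
      rw [← Real.Gamma_add_one (by positivity)]; push_cast; ring_nf
    rw [this]
    have h1 : 0 < Real.Gamma (ν + n + 1) := Real.Gamma_pos_of_pos (by positivity)
    have : (0 : ℝ) ≤ n := by positivity
    nlinarith

theorem Ent.mul_nat {b : ℕ → ℝ} (hb : Ent b) : Ent (fun n => n * b n) := by
  intro r hr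
  refine Summable.of_nonneg_of_le (fun n => by positivity) (fun n => ?_) (hb (2 * r) (by positivity))
  have : (n : ℝ) ≤ 2 ^ n := by exact_mod_cast Nat.lt_two_pow_self.le
  rw [abs_mul, Nat.abs_cast, mul_pow]
  calc (n : ℝ) * |b n| * r ^ n ≤ 2 ^ n * |b n| * r ^ n := by gcongr
    _ = _ := by ring

theorem Ent.mul_lin {b : ℕ → ℝ} (hb : Ent b) (c : ℝ) : Ent (fun n => (n + c) * b n) := by
  intro r hr
  refine Summable.of_nonneg_of_le (fun n => by positivity) (fun n => ?_)
    ((hb.mul_nat r hr).add ((hb r hr).mul_left |c|))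
  calc |(n + c) * b n| * r ^ n = |n * b n + c * b n| * r ^ n := by ring_nf
    _ ≤ (|n * b n| + |c * b n|) * r ^ n := by gcongr; exact abs_add_le _ _
    _ = _ := by rw [abs_mul c]; ring

theorem base_ent (ν : ℝ) (hν : 0 < ν) :
    Ent (fun n => (-1) ^ n / Real.Gamma (ν + n + 1) / n.factorial) := by
  intro r hr
  have hG : 0 < Real.Gamma (ν + 1) := Real.Gamma_pos_of_pos (by linarith)
  refine Summable.of_nonneg_of_le (fun n => by positivity) (fun n => ?_)
    ((Real.summable_pow_div_factorial r).mul_left (1 / Real.Gamma (ν + 1)))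
  have h1 := Gamma_lower ν hν n
  have hG' := hG.trans_le h1
  rw [abs_div, abs_div, abs_pow, abs_neg, abs_one, one_pow, abs_of_pos hG', Nat.abs_cast]
  calc 1 / Real.Gamma (ν + n + 1) / n.factorial * r ^ n
      ≤ 1 / Real.Gamma (ν + 1) / n.factorial * r ^ n := by gcongr
    _ = _ := by ring

theorem bco_succ (ν : ℝ) (k : ℕ) : bco ν (k + 1) = fun n => n * bco ν k n := by
  funext n; simp only [bco]; ring

theorem bco_ent (ν : ℝ) (hν : 0 < ν) (k : ℕ) : Ent (bco ν k) := by
  induction k with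
  | zero =>
    convert (base_ent ν hν).mul_lin (1 / 2) using 2 with n
    simp only [bco]; ring
  | succ k ih => rw [bco_succ]; exact ih.mul_nat

theorem ser_limit (ν : ℝ) (hν : 0 < ν) (k : ℕ) (t : ℝ) (ht : 0 ≤ t) :
    Filter.Tendsto (fun N : ℕ => ∑' n : ℕ, (n : ℝ) ^ k * ((n + 1 / 2) *
      ((-1) ^ n * (N.choose n) / Real.Gamma (ν + n + 1))) * (t / N) ^ n) Filter.atTop
      (nhds (ser (bco ν k) t)) := by
  apply tendsto_tsum_of_dominated_convergence (bco_ent ν hν k t ht)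
  · intro n
    have h1 : Filter.Tendsto (fun N : ℕ => (N : ℝ) * (t / N)) Filter.atTop (nhds t) := by
      apply tendsto_const_nhds.congr'
      filter_upwards [Filter.eventually_gt_atTop 0] with N hN
      field_simp
    have h2 := (ProbabilityTheory.tendsto_choose_mul_pow_atTop n h1).const_mul
      ((n : ℝ) ^ k * ((n + 1 / 2) * ((-1) ^ n / Real.Gamma (ν + n + 1))))
    convert h2 using 2
    · ring
    · simp only [bco]; ring
  · filter_upwards [Filter.eventually_gt_atTop 0] with N hN n
    have hNr : (0 : ℝ) < N := by exact_mod_cast hN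
    have h1 : (N.choose n : ℝ) * (t / N) ^ n ≤ t ^ n / n.factorial := by
      have := Nat.choose_le_pow_div (α := ℝ) n N
      calc (N.choose n : ℝ) * (t / N) ^ n ≤ (N ^ n / n.factorial) * (t / N) ^ n := by gcongr
        _ = _ := by rw [div_pow]; field_simp
    have hG' : 0 < Real.Gamma (ν + n + 1) := Real.Gamma_pos_of_pos (by positivity)
    have h2 : 0 ≤ (N.choose n : ℝ) * (t / N) ^ n := by positivity
    have e1 : (n : ℝ) ^ k * ((n + 1 / 2) * ((-1) ^ n * (N.choose n) / Real.Gamma (ν + n + 1)))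
      * (t / N) ^ n = ((n : ℝ) ^ k * (n + 1 / 2) * (-1) ^ n / Real.Gamma (ν + n + 1))
        * ((N.choose n : ℝ) * (t / N) ^ n) := by ring
    have e2 : |bco ν k n| * t ^ n =
      |(n : ℝ) ^ k * (n + 1 / 2) * (-1) ^ n / Real.Gamma (ν + n + 1)| * (t ^ n / n.factorial) := by
      rw [bco, abs_div _ (n.factorial : ℝ), Nat.abs_cast]; ring
    rw [e1, e2, norm_mul, Real.norm_eq_abs, Real.norm_of_nonneg h2]
    gcongr

theorem eval_tsum (Q : Polynomial ℝ) (x : ℝ) : Q.eval x = ∑' n, Q.coeff n * x ^ n := by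
  rw [Polynomial.eval_eq_sum_range, tsum_eq_sum]
  intro n hn
  rw [Polynomial.coeff_eq_zero_of_natDegree_lt (by simpa using hn), zero_mul]

theorem ser_laguerre (ν : ℝ) (hν : 0 < ν) (t : ℝ) (ht : 0 ≤ t) :
    ser (bco ν 0) t * ser (bco ν 2) t - ser (bco ν 1) t ^ 2 ≤ 0 := by
  have h := ((ser_limit ν hν 0 t ht).mul (ser_limit ν hν 2 t ht)).sub
    ((ser_limit ν hν 1 t ht).pow 2)
  refine le_of_tendsto' h (fun N => ?_)
  have h1 := ((lagP_posRooted N ν hν).step (1 / 2) 0 (by norm_num) le_rfl).laguerre (t / N)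
    (by positivity)
  have hc : ∀ n, (Polynomial.X * Polynomial.derivative (lagP N ν) + (Polynomial.C (1 / 2) -
      Polynomial.C 0 * Polynomial.X) * lagP N ν).coeff n = (n + 1 / 2) *
      ((-1) ^ n * (N.choose n) / Real.Gamma (ν + n + 1)) := by
    intro n
    rw [Polynomial.coeff_add, coeff_theta, Polynomial.C_0, zero_mul, sub_zero,
      Polynomial.coeff_C_mul, lagP_coeff N ν hν]
    ring
  rw [eval_tsum, eval_tsum, eval_tsum] at h1
  simp only [coeff_theta, hc] at h1
  simpa only [pow_zero, one_mul, pow_one, pow_two, mul_assoc] using h1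

theorem Ent.summable {b : ℕ → ℝ} (hb : Ent b) (t : ℝ) : Summable (fun n => b n * t ^ n) := by
  apply Summable.of_norm
  simpa [abs_mul, abs_pow] using hb |t| (abs_nonneg t)

theorem ser_hasDerivAt {b : ℕ → ℝ} (hb : Ent b) (t : ℝ) (ht : 0 < t) :
    HasDerivAt (ser b) (ser (fun n => n * b n) t / t) t := by
  have hu : Summable (fun n : ℕ => |n * b n| * (t + 1) ^ n * (2 / t)) :=
    (hb.mul_nat (t + 1) (by linarith)).mul_right _
  have h := hasDerivAt_tsum_of_isPreconnected (t := Set.Ioo (t / 2) (t + 1))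
    (g := fun n y => b n * y ^ n) (g' := fun n y => n * b n * y ^ n / y) (y := t) (y₀ := t)
    hu isOpen_Ioo isPreconnected_Ioo ?_ ?_ ⟨by linarith, by linarith⟩ (hb.summable t)
    ⟨by linarith, by linarith⟩
  · have e : ser (fun n => n * b n) t / t = ∑' n : ℕ, n * b n * t ^ n / t := by
      rw [ser, tsum_div_const]
    rw [e]
    exact h
  · intro n y hy
    have hy0 : 0 < y := by have := hy.1; linarith
    have e : n * b n * y ^ n / y = b n * (n * y ^ (n - 1)) := by
      cases n with
      | zero => simp
      | succ n => simp only [Nat.add_sub_cancel, pow_succ]; field_simp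
    change HasDerivAt _ (n * b n * y ^ n / y) y
    rw [e]
    exact (hasDerivAt_pow n y).const_mul (b n)
  · intro n y hy
    have hy0 : 0 < y := by have := hy.1; linarith
    rw [norm_div, norm_mul, Real.norm_eq_abs, Real.norm_of_nonneg (by positivity : 0 ≤ y ^ n),
      Real.norm_of_nonneg hy0.le, div_eq_mul_inv]
    have h1 : y⁻¹ ≤ 2 / t := by
      rw [inv_eq_one_div, div_le_div_iff₀ hy0 ht]; linarith [hy.1]
    have h2 := hy.2.le
    gcongr

theorem ser_analytic {b : ℕ → ℝ} (hb : Ent b) : AnalyticOnNhd ℝ (ser b) Set.univ := by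
  have hr : (FormalMultilinearSeries.ofScalars ℝ b).radius = ⊤ := by
    apply ENNReal.eq_top_of_forall_nnreal_le
    intro r
    apply FormalMultilinearSeries.le_radius_of_summable
    simpa [FormalMultilinearSeries.ofScalars_norm] using hb r r.2
  have h := (FormalMultilinearSeries.ofScalars ℝ b).hasFPowerSeriesOnBall (by rw [hr]; simp)
  have e : (FormalMultilinearSeries.ofScalars ℝ b).sum = ser b := by
    funext x
    exact FormalMultilinearSeries.ofScalars_sum_eq b x
  rw [e] at h
  intro x _
  exact h.analyticAt_of_mem (by rw [hr]; simp)

theorem dini_eq (ν : ℝ) (hν : 0 < ν) (x : ℝ) (hx : 0 ≤ x) :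
    dini ν x = 2 * (x / 2) ^ ν * ser (bco ν 0) ((x / 2) ^ 2) := by
  rcases hx.eq_or_lt with rfl | hx
  · have : ∀ n : ℕ, ν + 2 * (n : ℝ) ≠ 0 := fun n => by positivity
    simp [dini, besselJ, Real.zero_rpow hν.ne', Real.zero_rpow (this _)]
  have hy : 0 < x / 2 := by linarith
  set y := x / 2 with hydef
  have hxy : x = 2 * y := by rw [hydef]; ring
  let e : ℕ → ℝ := fun n => (-1) ^ n / Real.Gamma (ν + n + 1) / n.factorial
  have he : Ent e := base_ent ν hν
  have hJ : besselJ ν x = y ^ ν * ∑' n, e n * (y ^ 2) ^ n := by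
    rw [besselJ, ← tsum_mul_left]
    apply tsum_congr
    intro n
    rw [← hydef, Real.rpow_add hy, mul_comm (2 : ℝ), mul_comm (n : ℝ), Real.rpow_mul hy.le,
      Real.rpow_two, Real.rpow_natCast]
    simp only [e]
    ring
  have hJ1 : x * besselJ (ν + 1) x = - (2 * y ^ ν * ∑' n, (n * e n) * (y ^ 2) ^ n) := by
    rw [(he.mul_nat.summable (y ^ 2)).tsum_eq_zero_add]
    simp only [Nat.cast_zero, zero_mul, zero_add]
    rw [besselJ, ← tsum_mul_left, ← tsum_mul_left, ← tsum_neg]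
    apply tsum_congr
    intro n
    rw [← hydef, Real.rpow_add hy, Real.rpow_add hy, Real.rpow_one, Real.rpow_mul hy.le,
      Real.rpow_two, Real.rpow_natCast, hxy]
    simp only [e]
    have : ν + 1 + (n : ℝ) + 1 = ν + ((n + 1 : ℕ) : ℝ) + 1 := by push_cast; ring
    rw [this, Nat.factorial_succ]
    have hG' : 0 < Real.Gamma (ν + (n + 1 : ℕ) + 1) := Real.Gamma_pos_of_pos (by positivity)
    push_cast at *
    field_simp
    ring
  have hF : ser (bco ν 0) (y ^ 2) = (∑' n, (n * e n) * (y ^ 2) ^ n) +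
      1 / 2 * ∑' n, e n * (y ^ 2) ^ n := by
    rw [ser, ← tsum_mul_left, ← (he.mul_nat.summable (y ^ 2)).tsum_add
      ((he.summable (y ^ 2)).mul_left _)]
    apply tsum_congr
    intro n
    simp only [bco, e]; ring
  rw [dini, hJ, hJ1, hF]
  ring

theorem dini_hasDerivAt (ν : ℝ) (hν : 0 < ν) (x : ℝ) (hx : 0 < x) :
    HasDerivAt (dini ν) (2 * (x / 2) ^ ν / x *
      (ν * ser (bco ν 0) ((x / 2) ^ 2) + 2 * ser (bco ν 1) ((x / 2) ^ 2))) x := by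
  have hy : 0 < x / 2 := by linarith
  have h0 : HasDerivAt (fun x : ℝ => x / 2) (1 / 2) x := (hasDerivAt_id x).div_const 2
  have h1 : HasDerivAt (fun x : ℝ => (x / 2) ^ ν) _ x := h0.rpow_const (p := ν) (Or.inl hy.ne')
  have h2 := ser_hasDerivAt (bco_ent ν hν 0) ((x / 2) ^ 2) (by positivity)
  have h3 : HasDerivAt (fun x : ℝ => ser (bco ν 0) ((x / 2) ^ 2)) _ x :=
    HasDerivAt.comp (h := fun x : ℝ => (x / 2) ^ 2) x h2 (h0.pow 2)
  have h4 := (h1.const_mul 2).mul h3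
  have h5 : HasDerivAt (dini ν) _ x := h4.congr_of_eventuallyEq (by
    filter_upwards [lt_mem_nhds hx] with z hz
    exact dini_eq ν hν z hz.le)
  convert h5 using 1
  rw [← bco_succ, Real.rpow_sub_one hy.ne']
  simp only [zero_add]
  field_simp
  ring

theorem dini_unique_aux (ν : ℝ) (hν : 0 < ν) (x₁ x₂ : ℝ) (h₁ : 0 < x₁) (h₁₂ : x₁ < x₂)
    (hne : ∀ x ∈ Set.Icc x₁ x₂, dini ν x ≠ 0)
    (hd₁ : deriv (dini ν) x₁ = 0) (hd₂ : deriv (dini ν) x₂ = 0) : False := by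
  have hG : ∀ x, 0 < x → deriv (dini ν) x = 0 →
      ν * ser (bco ν 0) ((x / 2) ^ 2) + 2 * ser (bco ν 1) ((x / 2) ^ 2) = 0 := by
    intro x hx h
    rw [(dini_hasDerivAt ν hν x hx).deriv] at h
    refine (mul_eq_zero.1 h).resolve_left ?_
    positivity
  set t₁ := (x₁ / 2) ^ 2 with ht₁
  set t₂ := (x₂ / 2) ^ 2 with ht₂
  have ht₁0 : 0 < t₁ := by positivity
  have ht : t₁ < t₂ := by rw [ht₁, ht₂]; gcongr
  have hF : ∀ t ∈ Set.Icc t₁ t₂, ser (bco ν 0) t ≠ 0 := by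
    intro t ht h0
    have hx0 : 0 ≤ 2 * √t := by positivity
    have htn : 0 ≤ t := ht₁0.le.trans ht.1
    have hsq : (2 * √t / 2) ^ 2 = t := by
      rw [mul_div_cancel_left₀ _ two_ne_zero, Real.sq_sqrt htn]
    have b1 : x₁ / 2 ≤ √t := Real.le_sqrt_of_sq_le ht.1
    have b2 : √t ≤ x₂ / 2 := (Real.sqrt_le_left (by linarith)).2 ht.2
    apply hne (2 * √t) ⟨by linarith, by linarith⟩
    rw [dini_eq ν hν _ hx0, hsq, h0, mul_zero]
  have hder : ∀ t ∈ Set.Icc t₁ t₂, HasDerivAt (fun t => ser (bco ν 1) t / ser (bco ν 0) t)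
      ((ser (bco ν 2) t / t * ser (bco ν 0) t - ser (bco ν 1) t * (ser (bco ν 1) t / t))
        / ser (bco ν 0) t ^ 2) t := by
    intro t ht
    have htn : 0 < t := ht₁0.trans_le ht.1
    have a1 := ser_hasDerivAt (bco_ent ν hν 1) t htn
    have a0 := ser_hasDerivAt (bco_ent ν hν 0) t htn
    rw [← bco_succ] at a1 a0
    exact a1.div a0 (hF t ht)
  have hanti : AntitoneOn (fun t => ser (bco ν 1) t / ser (bco ν 0) t) (Set.Icc t₁ t₂) := by
    apply antitoneOn_of_deriv_nonpos (convex_Icc _ _)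
    · intro t ht
      exact (hder t ht).continuousAt.continuousWithinAt
    · intro t ht
      exact (hder t (interior_subset ht)).differentiableAt.differentiableWithinAt
    · intro t ht
      have ht := interior_subset ht
      have htn : 0 < t := ht₁0.trans_le ht.1
      rw [(hder t ht).deriv]
      apply div_nonpos_of_nonpos_of_nonneg _ (sq_nonneg _)
      have := ser_laguerre ν hν t htn.le
      have e : ser (bco ν 2) t / t * ser (bco ν 0) t - ser (bco ν 1) t * (ser (bco ν 1) t / t) =
        (ser (bco ν 0) t * ser (bco ν 2) t - ser (bco ν 1) t ^ 2) / t := by ring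
      rw [e]
      exact div_nonpos_of_nonpos_of_nonneg this htn.le
  have hval : ∀ t ∈ Set.Icc t₁ t₂, ν * ser (bco ν 0) t + 2 * ser (bco ν 1) t = 0 →
      ser (bco ν 1) t / ser (bco ν 0) t = - ν / 2 := by
    intro t ht h
    rw [div_eq_iff (hF t ht)]
    linarith
  have v1 := hval t₁ ⟨le_rfl, ht.le⟩ (hG x₁ h₁ hd₁)
  have v2 := hval t₂ ⟨ht.le, le_rfl⟩ (hG x₂ (h₁.trans h₁₂) hd₂)
  have hconst : ∀ t ∈ Set.Icc t₁ t₂, ν * ser (bco ν 0) t + 2 * ser (bco ν 1) t = 0 := by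
    intro t h
    have c1 := hanti ⟨le_rfl, ht.le⟩ h h.1
    have c2 := hanti h ⟨ht.le, le_rfl⟩ h.2
    simp only [v1, v2] at c1 c2
    have := le_antisymm c1 c2
    rw [div_eq_iff (hF t h)] at this
    linarith
  have han : AnalyticOnNhd ℝ (fun t => ν * ser (bco ν 0) t + 2 * ser (bco ν 1) t) Set.univ :=
    (analyticOnNhd_const.mul (ser_analytic (bco_ent ν hν 0))).add
      (analyticOnNhd_const.mul (ser_analytic (bco_ent ν hν 1)))
  have hz := han.eqOn_zero_of_preconnected_of_eventuallyEq_zero isPreconnected_univ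
    (Set.mem_univ ((t₁ + t₂) / 2)) (by
      filter_upwards [Icc_mem_nhds (show t₁ < (t₁ + t₂) / 2 by linarith)
        (show (t₁ + t₂) / 2 < t₂ by linarith)] with t h
      exact hconst t h)
  have h0 := hz (Set.mem_univ 0)
  have s0 : ∀ b : ℕ → ℝ, ser b 0 = b 0 := by
    intro b
    rw [ser, tsum_eq_single 0]
    · simp
    · intro n hn; simp [hn]
  have hGp : 0 < Real.Gamma (ν + 1) := Real.Gamma_pos_of_pos (by linarith)
  simp [s0, bco, hν.ne', hGp.ne'] at h0

theorem dini_continuousOn (ν : ℝ) (hν : 0 < ν) : ContinuousOn (dini ν) (Set.Ici 0) := by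
  have hc : Continuous (ser (bco ν 0)) := by
    rw [← continuousOn_univ]
    exact (ser_analytic (bco_ent ν hν 0)).continuousOn
  have : Continuous (fun x : ℝ => 2 * (x / 2) ^ ν * ser (bco ν 0) ((x / 2) ^ 2)) := by
    have h1 : Continuous (fun x : ℝ => (x / 2) ^ ν) :=
      (continuous_id.div_const 2).rpow_const (fun _ => Or.inr hν.le)
    exact (continuous_const.mul h1).mul (hc.comp (by fun_prop))
  exact this.continuousOn.congr (fun x hx => dini_eq ν hν x hx)


theorem dini_deriv_zeros_interlace (ν : ℝ) (hν : 0 < ν) (α : ℕ → ℝ)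
    (hα0 : α 0 = 0)
    (hαpos : ∀ n, 1 ≤ n → 0 < α n)
    (hαmono : ∀ m n, 1 ≤ m → m < n → α m < α n)
    (hαzero : ∀ n, 1 ≤ n → dini ν (α n) = 0)
    (hαall : ∀ x : ℝ, 0 < x → dini ν x = 0 → ∃ n, 1 ≤ n ∧ x = α n) :
    ∀ n, 1 ≤ n → ∃! x : ℝ, x ∈ Set.Ioo (α (n - 1)) (α n) ∧ deriv (dini ν) x = 0 := by
  intro n hn
  obtain ⟨k, rfl⟩ : ∃ k, n = k + 1 := ⟨n - 1, by omega⟩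
  rw [Nat.add_sub_cancel]
  have hnn : ∀ m, 0 ≤ α m := by
    intro m
    cases m with
    | zero => exact hα0.ge
    | succ m => exact (hαpos _ (by omega)).le
  have hlt : ∀ i j, i < j → α i < α j := by
    intro i j hij
    cases i with
    | zero => rw [hα0]; exact hαpos j (by omega)
    | succ i => exact hαmono _ _ (by omega) hij
  have hsm : StrictMono α := fun i j h => hlt i j h
  have hz : ∀ m, dini ν (α m) = 0 := by
    intro m
    cases m with
    | zero => rw [hα0, dini_eq ν hν 0 le_rfl]; simp [Real.zero_rpow hν.ne']
    | succ m => exact hαzero _ (by omega)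
  have hne : ∀ x ∈ Set.Ioo (α k) (α (k + 1)), dini ν x ≠ 0 := by
    intro x hx h0
    obtain ⟨m, hm, rfl⟩ := hαall x ((hnn k).trans_lt hx.1) h0
    have h1 := hsm.lt_iff_lt.1 hx.1
    have h2 := hsm.lt_iff_lt.1 hx.2
    omega
  have huniq : ∀ x ∈ Set.Ioo (α k) (α (k + 1)), ∀ y ∈ Set.Ioo (α k) (α (k + 1)),
      deriv (dini ν) x = 0 → deriv (dini ν) y = 0 → ¬ x < y := by
    intro x hx y hy hdx hdy hxy
    exact dini_unique_aux ν hν x y ((hnn k).trans_lt hx.1) hxy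
      (fun z hz => hne z ⟨hx.1.trans_le hz.1, hz.2.trans_lt hy.2⟩) hdx hdy
  obtain ⟨c, hc, hdc⟩ := exists_deriv_eq_zero (f := dini ν) (hlt k (k + 1) (by omega))
    ((dini_continuousOn ν hν).mono (fun x hx => (hnn k).trans hx.1)) (by rw [hz, hz])
  refine ⟨c, ⟨hc, hdc⟩, ?_⟩
  rintro y ⟨hy, hdy⟩
  exact le_antisymm (not_lt.1 (huniq c hc y hy hdc hdy)) (not_lt.1 (huniq y hy c hc hdy hdc))
end

section
/- Let ν > -1, let k ≥ 1, and assume α_{ν,k}² ≠ 2ν - 1. Then ∑_{n≥1, n≠k} 1/(α_{ν,n}² - α_{ν,k}²) = (1/(4α_{ν,k}²))·[2ν + 1 - (α_{ν,k}² + 2ν - 1)/(α_{ν,k}² - 2ν + 1)]. -/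
open Real Set

open Filter Topology Polynomial

lemma dz_rolle_inf (a : ℝ) (f f' : ℝ → ℝ) (hc : ContinuousWithinAt f (Ioi a) a) (h0 : f a = 0)
    (hd : ∀ x, a < x → HasDerivAt f (f' x) x) (hinf : Tendsto f atTop (𝓝 0)) :
    ∃ c, a < c ∧ f' c = 0 := by
  have h1 : Tendsto (fun s : ℝ => f (a - Real.log s)) (𝓝[>] (0:ℝ)) (𝓝 0) := by
    apply hinf.comp
    have := tendsto_neg_atBot_atTop.comp Real.tendsto_log_nhdsGT_zero
    exact (tendsto_atTop_add_const_left _ a this).congr (fun x => by simp [sub_eq_add_neg])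
  have h2 : Tendsto (fun s : ℝ => f (a - Real.log s)) (𝓝[<] (1:ℝ)) (𝓝 0) := by
    have h3 : Tendsto f (𝓝[>] a) (𝓝 0) := by
      have := hc.tendsto
      rwa [h0] at this
    apply h3.comp
    apply tendsto_nhdsWithin_of_tendsto_nhds_of_eventually_within
    · have : ContinuousAt (fun s : ℝ => a - Real.log s) 1 :=
        continuousAt_const.sub (Real.continuousAt_log one_ne_zero)
      have := this.tendsto
      simp only [Real.log_one, sub_zero] at this
      exact this.mono_left nhdsWithin_le_nhds
    · have : Ioo (0:ℝ) 1 ∈ 𝓝[<] (1:ℝ) := Ioo_mem_nhdsLT one_pos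
      filter_upwards [this] with s hs
      have := Real.log_neg hs.1 hs.2
      simp only [mem_Ioi]; linarith
  obtain ⟨c, hc, hc0⟩ := exists_hasDerivAt_eq_zero' (f' := fun s => f' (a - Real.log s) * (-s⁻¹))
    one_pos h1 h2 (by
      intro s hs
      have hl := Real.log_neg hs.1 hs.2
      have := (Real.hasDerivAt_log hs.1.ne').const_sub a
      exact (hd (a - Real.log s) (by linarith)).comp s this)
  have hl := Real.log_neg hc.1 hc.2
  refine ⟨a - Real.log c, by linarith, ?_⟩
  have := hc.1.ne'
  simpa [this] using hc0

/-- Weighted Rolle on a finite interval, weight `exp (-e z) z^c`. -/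
lemma dz_deriv_weight (c e : ℝ) (P : ℝ[X]) (x : ℝ) (hx : 0 < x) :
    HasDerivAt (fun z => Real.exp (-(e * z)) * z ^ c * P.eval z)
      (Real.exp (-(e * x)) * x ^ (c - 1) *
        ((c - e * x) * P.eval x + x * P.derivative.eval x)) x := by
  have h1 : HasDerivAt (fun z : ℝ => Real.exp (-(e * z))) (Real.exp (-(e * x)) * (-(e * 1))) x :=
    (((hasDerivAt_id x).const_mul e).neg).exp
  have h2 := Real.hasDerivAt_rpow_const (p := c) (Or.inl hx.ne')
  refine ((h1.fun_mul h2).fun_mul (P.hasDerivAt x)).congr_deriv ?_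
  have : x ^ c = x ^ (c - 1) * x := by
    rw [Real.rpow_sub_one hx.ne']; field_simp
  rw [this]; ring

lemma dz_cont_weight (c e : ℝ) (hc : 0 < c) (P : ℝ[X]) :
    Continuous (fun z => Real.exp (-(e * z)) * z ^ c * P.eval z) := by
  have := Real.continuous_rpow_const hc.le
  have := P.continuous
  fun_prop

lemma dz_rolle_step (c e : ℝ) (hc : 0 < c) (P : ℝ[X]) (a b : ℝ) (ha : 0 ≤ a) (hab : a < b)
    (hPa : a = 0 ∨ P.eval a = 0) (hPb : P.eval b = 0) :
    ∃ s, a < s ∧ s < b ∧ (c - e * s) * P.eval s + s * P.derivative.eval s = 0 := by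
  obtain ⟨s, hs, h⟩ := exists_hasDerivAt_eq_zero hab (dz_cont_weight c e hc P).continuousOn
    (by
      rcases hPa with rfl | h
      · simp [hPb, Real.zero_rpow hc.ne']
      · simp [hPb, h])
    (fun x hx => dz_deriv_weight c e P x (lt_of_le_of_lt ha hx.1))
  have hs0 : 0 < s := lt_of_le_of_lt ha hs.1
  refine ⟨s, hs.1, hs.2, ?_⟩
  have : Real.exp (-(e * s)) * s ^ (c - 1) ≠ 0 := by positivity
  exact (mul_eq_zero.mp h).resolve_left this

lemma dz_rolle_last (c : ℝ) (hc : 0 < c) (P : ℝ[X]) (a : ℝ) (ha : 0 ≤ a)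
    (hPa : a = 0 ∨ P.eval a = 0) :
    ∃ s, a < s ∧ (c - s) * P.eval s + s * P.derivative.eval s = 0 := by
  obtain ⟨s, hs, h⟩ := dz_rolle_inf a (fun z => Real.exp (-(1 * z)) * z ^ c * P.eval z) _
    (dz_cont_weight c 1 hc P).continuousWithinAt
    (by
      rcases hPa with rfl | h
      · simp [Real.zero_rpow hc.ne']
      · simp [h])
    (fun x hx => dz_deriv_weight c 1 P x (lt_of_le_of_lt ha hx))
    (by
      have : ∀ᶠ z : ℝ in atTop, ∑ i ∈ Finset.range (P.natDegree + 1),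
          P.coeff i * (z ^ (c + i) * Real.exp (-1 * z)) =
          Real.exp (-(1 * z)) * z ^ c * P.eval z := by
        filter_upwards [eventually_gt_atTop 0] with z hz
        rw [Polynomial.eval_eq_sum_range, Finset.mul_sum]
        refine Finset.sum_congr rfl fun i _ => ?_
        rw [Real.rpow_add hz, Real.rpow_natCast, neg_mul]; ring
      refine Tendsto.congr' this ?_
      have h0 : (0:ℝ) = ∑ i ∈ Finset.range (P.natDegree + 1), P.coeff i * 0 := by simp
      rw [h0]
      refine tendsto_finsetSum _ fun i _ => Tendsto.const_mul _ ?_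
      exact tendsto_rpow_mul_exp_neg_mul_atTop_nhds_zero _ _ one_pos)
  have hs0 : 0 < s := lt_of_le_of_lt ha hs
  refine ⟨s, hs, ?_⟩
  have : Real.exp (-(1 * s)) * s ^ (c - 1) ≠ 0 := by positivity
  simpa using (mul_eq_zero.mp h).resolve_left this

/-- normalized Laguerre polynomials -/
noncomputable def dzQ : ℕ → ℝ → ℝ[X]
  | 0, _ => 1
  | m + 1, μ => (1 - C (1 / (μ + 1)) * X) * dzQ m (μ + 1) +
      C (1 / (μ + 1)) * X * derivative (dzQ m (μ + 1))

noncomputable def dzPoch (c : ℝ) (n : ℕ) : ℝ := ∏ i ∈ Finset.range n, (c + i)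

lemma dzPoch_succ (c : ℝ) (n : ℕ) : dzPoch c (n + 1) = dzPoch c n * (c + n) := by
  simp [dzPoch, Finset.prod_range_succ]

lemma dzPoch_succ' (c : ℝ) (n : ℕ) : dzPoch c (n + 1) = c * dzPoch (c + 1) n := by
  simp only [dzPoch, Finset.prod_range_succ']
  rw [mul_comm]
  simp only [Nat.cast_zero, add_zero]
  congr 1
  refine Finset.prod_congr rfl fun i _ => ?_
  push_cast; ring

lemma dzPoch_pos (c : ℝ) (hc : 0 < c) (n : ℕ) : 0 < dzPoch c n :=
  Finset.prod_pos fun i _ => by positivity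

lemma dzQ_coeff (m : ℕ) : ∀ (μ : ℝ), -1 < μ → ∀ n,
    (dzQ m μ).coeff n = (-1) ^ n * (m.choose n : ℝ) / dzPoch (μ + 1) n := by
  induction m with
  | zero =>
    intro μ hμ n
    cases n with
    | zero => simp [dzQ, dzPoch]
    | succ n => simp [dzQ, Polynomial.coeff_one]
  | succ m ih =>
    intro μ hμ n
    have ih := ih (μ + 1) (by linarith)
    have hμ1 : 0 < μ + 1 := by linarith
    cases n with
    | zero => simp [dzQ, ih, dzPoch, sub_mul, mul_assoc]
    | succ n =>
      have hp := dzPoch_pos (μ + 1 + 1) (by linarith) n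
      have hq : 0 < μ + 1 + 1 + (n:ℝ) := by positivity
      have : (dzQ (m + 1) μ).coeff (n + 1) = (dzQ m (μ + 1)).coeff (n + 1)
          - 1 / (μ + 1) * (dzQ m (μ + 1)).coeff n
          + 1 / (μ + 1) * ((dzQ m (μ + 1)).coeff (n + 1) * (n + 1)) := by
        simp only [dzQ, sub_mul, one_mul, mul_assoc, Polynomial.coeff_add, Polynomial.coeff_sub,
          Polynomial.coeff_C_mul, Polynomial.coeff_X_mul, Polynomial.coeff_derivative]
      rw [this, ih, ih, dzPoch_succ' (μ + 1) n, dzPoch_succ, Nat.choose_succ_succ]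
      push_cast
      field_simp
      ring

lemma dzQ_natDegree (m : ℕ) (μ : ℝ) (hμ : -1 < μ) : (dzQ m μ).natDegree ≤ m := by
  rw [Polynomial.natDegree_le_iff_coeff_eq_zero]
  intro N hN
  rw [dzQ_coeff m μ hμ, Nat.choose_eq_zero_of_lt hN]
  simp

lemma dzQ_roots (m : ℕ) : ∀ (μ : ℝ), -1 < μ → ∃ r : ℕ → ℝ, r 0 = 0 ∧
    (∀ i < m, r i < r (i + 1) ∧ (dzQ m μ).eval (r (i + 1)) = 0) := by
  induction m with
  | zero => intro μ _; exact ⟨fun _ => 0, rfl, by simp⟩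
  | succ m ih =>
    intro μ hμ
    have hμ1 : 0 < μ + 1 := by linarith
    obtain ⟨r, r0, hr⟩ := ih (μ + 1) (by linarith)
    have hnn : ∀ i ≤ m, 0 ≤ r i := by
      intro i
      induction i with
      | zero => simp [r0]
      | succ i ihi => intro hi; exact (ihi (by omega)).trans (hr i (by omega)).1.le
    have hz : ∀ i ≤ m, r i = 0 ∨ (dzQ m (μ + 1)).eval (r i) = 0 := by
      intro i hi
      cases i with
      | zero => exact Or.inl r0
      | succ i => exact Or.inr (hr i (by omega)).2
    have hev : ∀ s, (dzQ (m + 1) μ).eval s = ((μ + 1 - s) * (dzQ m (μ + 1)).eval s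
        + s * (dzQ m (μ + 1)).derivative.eval s) / (μ + 1) := by
      intro s
      simp [dzQ]
      field_simp
    have hex : ∀ i, ∃ s, i ≤ m → r i < s ∧ (i < m → s < r (i + 1)) ∧
        (dzQ (m + 1) μ).eval s = 0 := by
      intro i
      rcases lt_trichotomy i m with h | h | h
      · obtain ⟨s, h1, h2, h3⟩ := dz_rolle_step (μ + 1) 1 hμ1 (dzQ m (μ + 1)) (r i) (r (i + 1))
          (hnn i h.le) (hr i h).1 (hz i h.le) (hr i h).2
        refine ⟨s, fun _ => ⟨h1, fun _ => h2, ?_⟩⟩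
        rw [one_mul] at h3
        rw [hev, h3, zero_div]
      · obtain ⟨s, h1, h3⟩ := dz_rolle_last (μ + 1) hμ1 (dzQ m (μ + 1)) (r i)
          (hnn i h.le) (hz i h.le)
        refine ⟨s, fun _ => ⟨h1, fun h' => absurd h' (by omega), ?_⟩⟩
        rw [hev, h3, zero_div]
      · exact ⟨0, fun h' => absurd h' (by omega)⟩
    choose s hs using hex
    refine ⟨fun i => if i = 0 then 0 else s (i - 1), by simp, ?_⟩
    intro i hi
    refine ⟨?_, by simpa using (hs i (by omega)).2.2⟩
    cases i with
    | zero => simpa [r0] using (hs 0 (by omega)).1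
    | succ i =>
      have h1 := (hs i (by omega)).2.1 (by omega)
      have h2 := (hs (i + 1) (by omega)).1
      simpa using h1.trans h2

noncomputable def dzT (m : ℕ) (μ : ℝ) : ℝ[X] := dzQ m μ + C 2 * X * derivative (dzQ m μ)

lemma dzT_coeff (m : ℕ) (μ : ℝ) (hμ : -1 < μ) (n : ℕ) :
    (dzT m μ).coeff n = (-1) ^ n * (2 * n + 1) * (m.choose n : ℝ) / dzPoch (μ + 1) n := by
  have : (dzT m μ).coeff n = (2 * n + 1) * (dzQ m μ).coeff n := by
    cases n with
    | zero => simp [dzT, mul_assoc]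
    | succ n =>
      simp only [dzT, mul_assoc, Polynomial.coeff_add,
          Polynomial.coeff_C_mul, Polynomial.coeff_X_mul, Polynomial.coeff_derivative]
      push_cast; ring
  rw [this, dzQ_coeff m μ hμ]; ring

lemma dzT_natDegree (m : ℕ) (μ : ℝ) (hμ : -1 < μ) : (dzT m μ).natDegree ≤ m := by
  rw [Polynomial.natDegree_le_iff_coeff_eq_zero]
  intro N hN
  rw [dzT_coeff m μ hμ, Nat.choose_eq_zero_of_lt hN]
  simp

lemma dzT_roots (m : ℕ) (μ : ℝ) (hμ : -1 < μ) : ∃ r : ℕ → ℝ, r 0 = 0 ∧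
    (∀ i < m, r i < r (i + 1) ∧ (dzT m μ).eval (r (i + 1)) = 0) := by
  obtain ⟨r, r0, hr⟩ := dzQ_roots m μ hμ
  have hnn : ∀ i ≤ m, 0 ≤ r i := by
    intro i
    induction i with
    | zero => simp [r0]
    | succ i ihi => intro hi; exact (ihi (by omega)).trans (hr i (by omega)).1.le
  have hz : ∀ i ≤ m, r i = 0 ∨ (dzQ m μ).eval (r i) = 0 := by
    intro i hi
    cases i with
    | zero => exact Or.inl r0
    | succ i => exact Or.inr (hr i (by omega)).2
  have hex : ∀ i, ∃ s, i < m → r i < s ∧ s < r (i + 1) ∧ (dzT m μ).eval s = 0 := by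
    intro i
    by_cases h : i < m
    · obtain ⟨s, h1, h2, h3⟩ := dz_rolle_step (1 / 2) 0 (by norm_num) (dzQ m μ) (r i) (r (i + 1))
          (hnn i h.le) (hr i h).1 (hz i h.le) (hr i h).2
      refine ⟨s, fun _ => ⟨h1, h2, ?_⟩⟩
      simp [dzT]
      linarith
    · exact ⟨0, fun h' => absurd h' h⟩
  choose s hs using hex
  refine ⟨fun i => if i = 0 then 0 else s (i - 1), by simp, ?_⟩
  intro i hi
  refine ⟨?_, by simpa using (hs i (by omega)).2.2⟩
  cases i with
  | zero => simpa [r0] using (hs 0 (by omega)).1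
  | succ i =>
    have h1 := (hs i (by omega)).2.1
    have h2 := (hs (i + 1) (by omega)).1
    simpa using h1.trans h2

lemma dzT_factor (m : ℕ) (μ : ℝ) (hμ : -1 < μ) : ∃ b : ℕ → ℝ, (∀ i, 0 ≤ b i) ∧
    (∀ i j, i ≤ j → b j ≤ b i) ∧ (∀ i, m ≤ i → b i = 0) ∧
    ∀ z, (dzT m μ).eval z = ∏ i ∈ Finset.range m, (1 - b i * z) := by
  obtain ⟨r, r0, hr⟩ := dzT_roots m μ hμ
  have hmono : ∀ j ≤ m, ∀ i < j, r i < r j := by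
    intro j
    induction j with
    | zero => intro _ i hi; omega
    | succ j ih =>
      intro hj i hi
      rcases Nat.lt_succ_iff_lt_or_eq.mp hi with h | h
      · exact (ih (by omega) i h).trans (hr j (by omega)).1
      · rw [h]; exact (hr j (by omega)).1
  have hpos : ∀ i < m, 0 < r (i + 1) := fun i hi => by
    have := hmono (i + 1) (by omega) 0 (by omega); rwa [r0] at this
  refine ⟨fun i => if i < m then 1 / r (i + 1) else 0, ?_, ?_, ?_, ?_⟩
  · intro i
    by_cases h : i < m
    · simp [h, (hpos i h).le]
    · simp [h]
  · intro i j hij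
    by_cases h : j < m
    · have hi : i < m := by omega
      simp only [h, hi, if_true]
      apply one_div_le_one_div_of_le (hpos i hi)
      rcases eq_or_lt_of_le hij with rfl | h'
      · rfl
      · exact (hmono (j + 1) (by omega) (i + 1) (by omega)).le
    · by_cases hi : i < m
      · simp [h, hi, (hpos i hi).le]
      · simp [h, hi]
  · intro i hi; simp [not_lt.mpr hi]
  · intro z
    have key : dzT m μ = ∏ i ∈ Finset.range m, (1 - C (1 / r (i + 1)) * X) := by
      have hinj : Set.InjOn r (Finset.range (m + 1)) := by
        intro i hi j hj hij
        simp only [Finset.coe_range, mem_Iio] at hi hj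
        rcases lt_trichotomy i j with h | h | h
        · exact absurd hij (hmono j (by omega) i h).ne
        · exact h
        · exact absurd hij (hmono i (by omega) j h).ne'
      have hcard : ((Finset.range (m + 1)).image r).card = m + 1 := by
        rw [Finset.card_image_of_injOn hinj, Finset.card_range]
      apply Polynomial.eq_of_degrees_lt_of_eval_finset_eq ((Finset.range (m + 1)).image r)
      · rw [hcard]
        refine lt_of_le_of_lt Polynomial.degree_le_natDegree ?_
        exact_mod_cast Nat.lt_succ_of_le (dzT_natDegree m μ hμ)
      · rw [hcard]
        refine lt_of_le_of_lt Polynomial.degree_le_natDegree ?_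
        have : (∏ i ∈ Finset.range m, (1 - C (1 / r (i + 1)) * X) : ℝ[X]).natDegree ≤ m := by
          refine (Polynomial.natDegree_prod_le _ _).trans ?_
          calc _ ≤ ∑ i ∈ Finset.range m, 1 := by
                refine Finset.sum_le_sum fun i _ => ?_
                compute_degree
            _ = m := by simp
        exact_mod_cast Nat.lt_succ_of_le this
      · intro x hx
        obtain ⟨i, hi, rfl⟩ := Finset.mem_image.mp hx
        rw [Finset.mem_range] at hi
        rw [Polynomial.eval_prod]
        cases i with
        | zero =>
          rw [r0, ← Polynomial.coeff_zero_eq_eval_zero, dzT_coeff m μ hμ]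
          simp [dzPoch]
        | succ i =>
          rw [(hr i (by omega)).2, eq_comm]
          apply Finset.prod_eq_zero (i := i) (by simp; omega)
          have := (hpos i (by omega)).ne'
          simp [this]
    rw [key, Polynomial.eval_prod]
    refine Finset.prod_congr rfl fun i hi => ?_
    simp [Finset.mem_range.mp hi]

noncomputable def dzW (ν : ℝ) (n : ℕ) : ℝ :=
  (2 * n + 1) / (4 ^ n * (n.factorial : ℝ) * dzPoch (ν + 1) n)

lemma dzW_pos (ν : ℝ) (hν : -1 < ν) (n : ℕ) : 0 < dzW ν n := by
  have := dzPoch_pos (ν + 1) (by linarith) n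
  unfold dzW; positivity

lemma dzW_succ (ν : ℝ) (hν : -1 < ν) (n : ℕ) : dzW ν (n + 1) =
    dzW ν n * ((2 * n + 3) / ((2 * n + 1) * (4 * (n + 1) * (ν + 1 + n)))) := by
  have := dzPoch_pos (ν + 1) (by linarith) n
  have h2 : 0 < ν + 1 + (n:ℝ) := by have := n.cast_nonneg (α := ℝ); linarith
  unfold dzW
  rw [dzPoch_succ, Nat.factorial_succ]
  push_cast
  field_simp
  ring

noncomputable def dzK (ν : ℝ) : ℝ := 1 + 2 / (ν + 1)

lemma dzK_one_le (ν : ℝ) (hν : -1 < ν) : 1 ≤ dzK ν := by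
  have : 0 < ν + 1 := by linarith
  have : 0 < 2 / (ν + 1) := by positivity
  unfold dzK; linarith

lemma dzW_le (ν : ℝ) (hν : -1 < ν) (n : ℕ) :
    dzW ν n ≤ dzK ν ^ (2 * n) / ((2 * n).factorial : ℝ) := by
  have hK := dzK_one_le ν hν
  have hν1 : 0 < ν + 1 := by linarith
  induction n with
  | zero => simp [dzW, dzPoch]
  | succ n ih =>
    have hn := n.cast_nonneg (α := ℝ)
    have h2 : 0 < ν + 1 + (n:ℝ) := by linarith
    rw [dzW_succ ν hν]
    have e1 : dzK ν ^ (2 * (n + 1)) / ((2 * (n + 1)).factorial : ℝ) =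
        dzK ν ^ (2 * n) / ((2 * n).factorial : ℝ) *
          (dzK ν ^ 2 / ((2 * n + 2) * (2 * n + 1))) := by
      rw [show 2 * (n + 1) = 2 * n + 1 + 1 by ring, Nat.factorial_succ, Nat.factorial_succ]
      push_cast
      field_simp
      ring
    rw [e1]
    apply mul_le_mul ih _ (by positivity) (by positivity)
    rw [div_le_div_iff₀ (by positivity) (by positivity)]
    have h3 : 2 * (n:ℝ) + 3 ≤ dzK ν ^ 2 * (2 * (ν + 1 + n)) := by
      have h4 : 2 * (n:ℝ) + 3 ≤ dzK ν * (2 * (ν + 1 + n)) := by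
        have : dzK ν * (2 * (ν + 1 + n)) = 2 * (ν + 1 + n) + 4 * (1 + n / (ν + 1)) := by
          unfold dzK; field_simp; ring
        rw [this]
        have : 0 ≤ n / (ν + 1) := by positivity
        linarith
      have : dzK ν ≤ dzK ν ^ 2 := by nlinarith
      have := mul_le_mul_of_nonneg_right this (show 0 ≤ 2 * (ν + 1 + (n:ℝ)) by positivity)
      linarith
    have h5 := mul_le_mul_of_nonneg_right h3
      (show 0 ≤ (2 * (n:ℝ) + 2) * (2 * n + 1) by positivity)
    nlinarith [h5]

lemma dzW_summable_sq (ν : ℝ) (hν : -1 < ν) (s : ℝ) :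
    Summable (fun n => dzW ν n * (s ^ 2) ^ n) ∧
      ∑' n, dzW ν n * (s ^ 2) ^ n ≤ Real.cosh (dzK ν * s) := by
  have hb : ∀ n, dzW ν n * (s ^ 2) ^ n ≤ (dzK ν * s) ^ (2 * n) / ((2 * n).factorial : ℝ) := by
    intro n
    have := mul_le_mul_of_nonneg_right (dzW_le ν hν n) (show 0 ≤ (s ^ 2) ^ n by positivity)
    refine this.trans (le_of_eq ?_)
    rw [mul_pow, ← pow_mul]; ring
  have hc := Real.hasSum_cosh (dzK ν * s)
  have hs : Summable (fun n => dzW ν n * (s ^ 2) ^ n) :=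
    Summable.of_nonneg_of_le (fun n => by have := dzW_pos ν hν n; positivity) hb hc.summable
  exact ⟨hs, hc.tsum_eq ▸ hs.tsum_le_tsum hb hc.summable⟩

lemma dzW_summable (ν : ℝ) (hν : -1 < ν) (t : ℝ) : Summable (fun n => dzW ν n * |t| ^ n) := by
  have := (dzW_summable_sq ν hν (√|t|)).1
  simpa [Real.sq_sqrt (abs_nonneg t)] using this

noncomputable def dzF (ν z : ℝ) : ℝ := ∑' n : ℕ, (-1) ^ n * dzW ν n * z ^ n

lemma dzGamma (ν : ℝ) (hν : -1 < ν) (n : ℕ) :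
    Real.Gamma (ν + n + 1) = Real.Gamma (ν + 1) * dzPoch (ν + 1) n := by
  induction n with
  | zero => simp [dzPoch]
  | succ n ih =>
    have h2 : 0 < ν + 1 + (n:ℝ) := by have := n.cast_nonneg (α := ℝ); linarith
    rw [dzPoch_succ, ← mul_assoc, ← ih]
    have := Real.Gamma_add_one (s := ν + n + 1) (by linarith)
    push_cast
    rw [show ν + (n + 1) + 1 = ν + n + 1 + 1 by ring, this]; ring

lemma dz_Dcal (ν : ℝ) (hν : -1 < ν) (x : ℝ) : Dcal ν x = dzF ν (x ^ 2) := by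
  unfold Dcal dzF dzW
  congr 1; ext n
  have h1 := dzPoch_pos (ν + 1) (by linarith) n
  have h2 := Real.Gamma_pos_of_pos (show 0 < ν + 1 by linarith)
  rw [dzGamma ν hν, pow_mul, pow_mul]
  norm_num
  field_simp

/-- the approximating polynomials -/
noncomputable def dzP (ν : ℝ) (m : ℕ) (z : ℝ) : ℝ := (dzT m ν).eval (z / (4 * m))

noncomputable def dzRho (m n : ℕ) : ℝ := (m.descFactorial n : ℝ) / (m : ℝ) ^ n

lemma dzRho_nonneg (m n : ℕ) : 0 ≤ dzRho m n := by unfold dzRho; positivity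
lemma dzRho_le (m n : ℕ) : dzRho m n ≤ 1 := by
  unfold dzRho
  apply div_le_one_of_le₀ _ (by positivity)
  exact_mod_cast Nat.descFactorial_le_pow m n

lemma dzRho_tendsto (n : ℕ) : Tendsto (fun m => dzRho m n) atTop (𝓝 1) := by
  induction n with
  | zero => simp [dzRho]
  | succ n ih =>
    have h : Tendsto (fun m : ℕ => dzRho m n * (1 - (n:ℝ) / m)) atTop (𝓝 (1 * (1 - 0))) :=
      ih.mul (tendsto_const_nhds.sub (tendsto_const_div_atTop_nhds_zero_nat (n:ℝ)))
    rw [sub_zero, mul_one] at h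
    refine h.congr' ?_
    filter_upwards [eventually_gt_atTop n] with m hm
    have : (0:ℝ) < m := by exact_mod_cast (by omega : 0 < m)
    unfold dzRho
    rw [Nat.descFactorial_succ, Nat.cast_mul, Nat.cast_sub hm.le]
    field_simp
    ring

lemma dzP_eq (ν : ℝ) (hν : -1 < ν) (m : ℕ) (z : ℝ) :
    dzP ν m z = ∑' n : ℕ, (-1) ^ n * dzW ν n * dzRho m n * z ^ n := by
  rw [tsum_eq_sum (s := Finset.range (m + 1))]
  · unfold dzP
    rw [Polynomial.eval_eq_sum_range' (n := m + 1) (Nat.lt_succ_of_le (dzT_natDegree m ν hν))]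
    refine Finset.sum_congr rfl fun n hn => ?_
    rw [dzT_coeff m ν hν]
    unfold dzW dzRho
    have h1 := dzPoch_pos (ν + 1) (by linarith) n
    rw [Nat.descFactorial_eq_factorial_mul_choose, div_pow, mul_pow]
    push_cast
    field_simp
  · intro n hn
    have : m < n := by simpa using hn
    simp [dzRho, Nat.descFactorial_eq_zero_iff_lt.mpr this]

lemma dzP_tendsto (ν : ℝ) (hν : -1 < ν) (z : ℝ) :
    Tendsto (fun m => dzP ν m z) atTop (𝓝 (dzF ν z)) := by
  simp_rw [dzP_eq ν hν]
  unfold dzF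
  refine tendsto_tsum_of_dominated_convergence (dzW_summable ν hν z) ?_ ?_
  · intro n
    have := ((dzRho_tendsto n).const_mul ((-1) ^ n * dzW ν n)).mul_const (z ^ n)
    simpa using this
  · refine Eventually.of_forall fun m n => ?_
    have h1 := dzW_pos ν hν n
    have h2 := dzRho_nonneg m n
    have h3 := dzRho_le m n
    rw [Real.norm_eq_abs, abs_mul, abs_mul, abs_mul, abs_pow, abs_pow, abs_neg, abs_one, one_pow,
      one_mul, abs_of_pos h1, abs_of_nonneg h2]
    have : dzW ν n * dzRho m n ≤ dzW ν n * 1 := by gcongr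
    rw [mul_one] at this
    gcongr

lemma dzP_neg_le (ν : ℝ) (hν : -1 < ν) (m : ℕ) (s : ℝ) (hs : 0 ≤ s) :
    dzP ν m (-(s ^ 2)) ≤ Real.exp (dzK ν * s) := by
  have h := dzW_summable_sq ν hν s
  have hK := dzK_one_le ν hν
  have hle : ∀ n : ℕ, (-1) ^ n * dzW ν n * dzRho m n * (-(s ^ 2)) ^ n ≤ dzW ν n * (s ^ 2) ^ n := by
    intro n
    have e : (-1 : ℝ) ^ n * dzW ν n * dzRho m n * (-(s ^ 2)) ^ n
        = dzW ν n * dzRho m n * (s ^ 2) ^ n := by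
      have : (-1 : ℝ) ^ n * (-(s ^ 2)) ^ n = (s ^ 2) ^ n := by rw [← mul_pow]; simp
      calc _ = dzW ν n * dzRho m n * ((-1 : ℝ) ^ n * (-(s ^ 2)) ^ n) := by ring
        _ = _ := by rw [this]
    rw [e]
    have h1 := dzW_pos ν hν n
    have h3 := dzRho_le m n
    have : dzW ν n * dzRho m n ≤ dzW ν n * 1 := by gcongr
    rw [mul_one] at this
    gcongr
  calc dzP ν m (-(s ^ 2)) = ∑' n : ℕ, (-1) ^ n * dzW ν n * dzRho m n * (-(s ^ 2)) ^ n :=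
        dzP_eq ν hν m _
    _ ≤ ∑' n, dzW ν n * (s ^ 2) ^ n := by
        refine Summable.tsum_le_tsum hle ?_ h.1
        apply summable_of_hasFiniteSupport
        refine (Finset.finite_toSet (Finset.range (m + 1))).subset ?_
        intro n hn
        by_contra hc
        have : m < n := by simpa using hc
        exact hn (by simp [dzRho, Nat.descFactorial_eq_zero_iff_lt.mpr this])
    _ ≤ Real.cosh (dzK ν * s) := h.2
    _ ≤ _ := by
        rw [Real.cosh_eq]
        have : Real.exp (-(dzK ν * s)) ≤ Real.exp (dzK ν * s) := by
          apply Real.exp_le_exp.mpr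
          have : 0 ≤ dzK ν * s := by positivity
          linarith
        linarith

lemma dzP_factor (ν : ℝ) (hν : -1 < ν) (m : ℕ) : ∃ b : ℕ → ℝ,
    (∀ i : ℕ, b i ∈ Icc 0 (Real.exp (dzK ν) / ((i:ℝ) + 1) ^ 2)) ∧
    ∀ z, dzP ν m z = ∏' i, (1 + -(b i * z)) := by
  obtain ⟨b, b0, bmono, bz, hb⟩ := dzT_factor m ν hν
  have hprod : ∀ z, dzP ν m z = ∏ i ∈ Finset.range m, (1 + -(b i / (4 * m) * z)) := by
    intro z
    rw [dzP, hb]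
    refine Finset.prod_congr rfl fun i _ => ?_
    ring
  refine ⟨fun i => b i / (4 * m), ?_, ?_⟩
  · intro j
    have hj0 : 0 ≤ b j / (4 * m) := div_nonneg (b0 j) (by positivity)
    refine ⟨hj0, ?_⟩
    rw [le_div_iff₀ (by positivity)]
    by_cases hjm : j < m
    swap
    · simp [bz j (by omega), Real.exp_nonneg]
    have h1 := dzP_neg_le ν hν m ((j:ℝ) + 1) (by positivity)
    have h2 : (b j / (4 * m) * ((j:ℝ) + 1) ^ 2) ^ (j + 1) ≤ dzP ν m (-(((j:ℝ) + 1) ^ 2)) := by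
      rw [hprod]
      calc (b j / (4 * m) * ((j:ℝ) + 1) ^ 2) ^ (j + 1)
          = ∏ i ∈ Finset.range (j + 1), (b j / (4 * m) * ((j:ℝ) + 1) ^ 2) := by simp
        _ ≤ ∏ i ∈ Finset.range (j + 1), (1 + -(b i / (4 * m) * -(((j:ℝ) + 1) ^ 2))) := by
          refine Finset.prod_le_prod (fun i _ => by positivity) fun i hi => ?_
          have hbi : b j ≤ b i := bmono i j (by simp at hi; omega)
          have : b j / (4 * m) * ((j:ℝ) + 1) ^ 2 ≤ b i / (4 * m) * ((j:ℝ) + 1) ^ 2 := by gcongr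
          linarith
        _ ≤ _ := by
          refine Finset.prod_le_prod_of_subset_of_one_le ?_ ?_ ?_
          · intro i hi; simp at hi ⊢; omega
          · intro i _
            have : 0 ≤ b i / (4 * m) * (((j:ℝ) + 1) ^ 2) :=
              mul_nonneg (div_nonneg (b0 i) (by positivity)) (by positivity)
            linarith
          · intro i _ _
            have : 0 ≤ b i / (4 * m) * (((j:ℝ) + 1) ^ 2) :=
              mul_nonneg (div_nonneg (b0 i) (by positivity)) (by positivity)
            linarith
    have h3 : Real.exp (dzK ν * ((j:ℝ) + 1)) = Real.exp (dzK ν) ^ (j + 1) := by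
      rw [← Real.exp_nat_mul]; push_cast; ring_nf
    rw [h3] at h1
    exact le_of_pow_le_pow_left₀ (by omega) (Real.exp_nonneg _) (h2.trans h1)
  · intro z
    rw [hprod, tprod_eq_prod]
    intro i hi
    simp [bz i (by simpa using hi)]

lemma dz_bound_summable (A : ℝ) : Summable (fun i : ℕ => A / ((i:ℝ) + 1) ^ 2) := by
  have h : Summable (fun n : ℕ => 1 / (n:ℝ) ^ 2) :=
    Real.summable_one_div_nat_pow.mpr (by norm_num)
  have := ((summable_nat_add_iff 1).mpr h).mul_left A
  simpa [div_eq_mul_inv] using this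

theorem dzF_factor (ν : ℝ) (hν : -1 < ν) : ∃ b : ℕ → ℝ, (∀ i, 0 ≤ b i) ∧ Summable b ∧
    ∀ z, dzF ν z = ∏' i, (1 + -(b i * z)) := by
  choose b hb hprod using dzP_factor ν hν
  have hcomp : IsCompact (Set.pi Set.univ
      (fun i : ℕ => Icc (0:ℝ) (Real.exp (dzK ν) / ((i:ℝ) + 1) ^ 2))) :=
    isCompact_univ_pi fun i => isCompact_Icc
  obtain ⟨β, hβ, φ, hφ, hlim⟩ := hcomp.tendsto_subseq (x := b) (fun m i _ => hb m i)
  have hβ' : ∀ i : ℕ, β i ∈ Icc (0:ℝ) (Real.exp (dzK ν) / ((i:ℝ) + 1) ^ 2) := fun i => hβ i trivial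
  refine ⟨β, fun i => (hβ' i).1, ?_, ?_⟩
  · exact Summable.of_nonneg_of_le (fun i => (hβ' i).1) (fun i => (hβ' i).2) (dz_bound_summable _)
  · intro z
    have h1 : Tendsto (fun m => dzP ν (φ m) z) atTop (𝓝 (dzF ν z)) :=
      (dzP_tendsto ν hν z).comp hφ.tendsto_atTop
    have h2 : Tendsto (fun m => dzP ν (φ m) z) atTop (𝓝 (∏' i, (1 + -(β i * z)))) := by
      simp_rw [hprod]
      refine tendsto_tprod_one_add_of_dominated_convergence
        ((dz_bound_summable (Real.exp (dzK ν))).mul_right |z|) ?_ ?_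
      · intro i
        exact (((tendsto_pi_nhds.mp hlim) i).mul_const z).neg
      · refine Eventually.of_forall fun m i => ?_
        rw [norm_neg, Real.norm_eq_abs, abs_mul, abs_of_nonneg (hb (φ m) i).1]
        exact mul_le_mul_of_nonneg_right (hb (φ m) i).2 (abs_nonneg _)
    exact tendsto_nhds_unique h1 h2

def dzE (a : ℕ → ℝ) : Prop := ∀ r : ℝ, 0 ≤ r → Summable (fun n => |a n| * r ^ n)
def dzD (a : ℕ → ℝ) (n : ℕ) : ℝ := (n + 1) * a (n + 1)
noncomputable def dzS (a : ℕ → ℝ) (z : ℝ) : ℝ := ∑' n, a n * z ^ n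

lemma dzE_D {a : ℕ → ℝ} (ha : dzE a) : dzE (dzD a) := by
  intro r hr
  have h := (summable_nat_add_iff 1).mpr (ha (2 * max r 1) (by positivity))
  refine Summable.of_nonneg_of_le (fun n => by positivity) (fun n => ?_) h
  have h1 : (n:ℝ) + 1 ≤ 2 ^ (n + 1) := by
    exact_mod_cast (Nat.lt_two_pow_self (n := n + 1)).le
  have h2 : r ^ n ≤ (max r 1) ^ (n + 1) :=
    (pow_le_pow_left₀ hr (le_max_left r 1) n).trans
      (pow_le_pow_right₀ (le_max_right r 1) (Nat.le_succ n))
  unfold dzD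
  rw [abs_mul, abs_of_nonneg (by positivity : (0:ℝ) ≤ n + 1), mul_pow]
  calc (n + 1 : ℝ) * |a (n + 1)| * r ^ n = |a (n + 1)| * ((n + 1) * r ^ n) := by ring
    _ ≤ |a (n + 1)| * (2 ^ (n + 1) * (max r 1) ^ (n + 1)) := by gcongr

lemma dzE_summable {a : ℕ → ℝ} (ha : dzE a) (z : ℝ) : Summable (fun n => a n * z ^ n) := by
  have := ha |z| (abs_nonneg z)
  refine Summable.of_norm ?_
  simpa [abs_mul] using this

lemma dzS_deriv {a : ℕ → ℝ} (ha : dzE a) (z : ℝ) : HasDerivAt (dzS a) (dzS (dzD a) z) z := by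
  have hR : 0 ≤ |z| + 1 := by positivity
  have hu0 := dzE_D ha (|z| + 1) hR
  have hu : Summable (fun n : ℕ => |a n| * (n * (|z| + 1) ^ (n - 1))) := by
    rw [← summable_nat_add_iff 1]
    refine hu0.congr fun n => ?_
    unfold dzD
    rw [abs_mul, abs_of_nonneg (by positivity : (0:ℝ) ≤ n + 1)]
    push_cast
    ring
  have h := hasDerivAt_tsum_of_isPreconnected (𝕜 := ℝ) (F := ℝ) (g := fun n y => a n * y ^ n)
    (g' := fun n y => a n * (n * y ^ (n - 1))) (t := Metric.ball 0 (|z| + 1)) (y₀ := 0) (y := z)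
    hu Metric.isOpen_ball (convex_ball 0 _).isPreconnected
    (fun n y _ => (hasDerivAt_pow n y).const_mul (a n))
    (fun n y hy => by
      have hy : |y| ≤ |z| + 1 := by
        have := (mem_ball_zero_iff.mp hy).le; simpa using this
      rw [Real.norm_eq_abs, abs_mul, abs_mul, abs_pow, Nat.abs_cast]
      gcongr)
    (by simp; positivity) (dzE_summable ha 0) (by simp)
  refine h.congr_deriv ?_
  unfold dzS
  rw [Summable.tsum_eq_zero_add]
  · simp only [Nat.cast_zero, zero_mul, mul_zero, zero_add, dzD]
    congr 1; ext n; push_cast; ring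
  · rw [← summable_nat_add_iff 1]
    refine (dzE_summable (dzE_D ha) z).congr fun n => ?_
    unfold dzD; push_cast; ring

lemma dzS_mul {a : ℕ → ℝ} (ha : dzE a) (z : ℝ) :
    HasSum (fun n : ℕ => n * a n * z ^ n) (z * dzS (dzD a) z) := by
  have h1 := ((dzE_summable (dzE_D ha) z).hasSum).mul_left z
  rw [← hasSum_nat_add_iff' 1]
  simp only [Finset.range_one, Finset.sum_singleton, Nat.cast_zero, zero_mul, sub_zero]
  convert! h1 using 1
  ext n; simp only [dzD]; push_cast; ring

noncomputable def dzV (ν : ℝ) (n : ℕ) : ℝ :=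
  (-1) ^ n / (4 ^ n * (n.factorial : ℝ) * dzPoch (ν + 1) n)

lemma dzV_W (ν : ℝ) (n : ℕ) : (2 * n + 1) * dzV ν n = (-1) ^ n * dzW ν n := by
  unfold dzV dzW; ring

lemma dzV_E (ν : ℝ) (hν : -1 < ν) : dzE (dzV ν) := by
  intro r hr
  have := dzW_summable ν hν r
  rw [abs_of_nonneg hr] at this
  refine Summable.of_nonneg_of_le (fun n => by positivity) (fun n => ?_) this
  have h : dzW ν n = (2 * n + 1) * |dzV ν n| := by
    have h1 := congrArg abs (dzV_W ν n)
    rw [abs_mul, abs_mul, abs_pow, abs_neg, abs_one, one_pow, one_mul,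
      abs_of_pos (dzW_pos ν hν n), abs_of_nonneg (by positivity : (0:ℝ) ≤ 2 * n + 1)] at h1
    exact h1.symm
  have h2 : |dzV ν n| ≤ dzW ν n := by
    rw [h]
    have := abs_nonneg (dzV ν n)
    have : 0 ≤ (n:ℝ) * |dzV ν n| := by positivity
    linarith
  gcongr

lemma dzV_succ (ν : ℝ) (hν : -1 < ν) (n : ℕ) :
    (n + 1) * (ν + 1 + n) * dzV ν (n + 1) = - dzV ν n / 4 := by
  have h1 := dzPoch_pos (ν + 1) (by linarith) n
  have h2 : 0 < ν + 1 + (n:ℝ) := by have := n.cast_nonneg (α := ℝ); linarith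
  unfold dzV
  rw [dzPoch_succ, Nat.factorial_succ]
  push_cast
  field_simp
  ring

lemma dzF_eq (ν : ℝ) (hν : -1 < ν) (z : ℝ) :
    dzF ν z = dzS (dzV ν) z + 2 * (z * dzS (dzD (dzV ν)) z) := by
  have h1 := (dzE_summable (dzV_E ν hν) z).hasSum
  have h2 := (dzS_mul (dzV_E ν hν) z).mul_left 2
  have := (h1.add h2).tsum_eq
  unfold dzF
  rw [show dzS (dzV ν) z = ∑' n, dzV ν n * z ^ n from rfl, ← this]
  congr 1; ext n
  rw [← dzV_W]; ring

lemma dz_ode (ν : ℝ) (hν : -1 < ν) (z : ℝ) :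
    z * dzS (dzD (dzD (dzV ν))) z + (ν + 1) * dzS (dzD (dzV ν)) z + dzS (dzV ν) z / 4 = 0 := by
  have h1 := (dzE_summable (dzV_E ν hν) z).hasSum.div_const 4
  have h2 := (dzE_summable (dzE_D (dzV_E ν hν)) z).hasSum.mul_left (ν + 1)
  have h3 := dzS_mul (dzE_D (dzV_E ν hν)) z
  have h := (h3.add h2).add h1
  refine h.unique ?_
  convert! hasSum_zero using 1
  ext n
  have := dzV_succ ν hν n
  unfold dzD
  linear_combination z ^ n * this

lemma dzF_deriv (ν : ℝ) (hν : -1 < ν) (z : ℝ) : HasDerivAt (dzF ν)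
    ((1 - 2 * ν) * dzS (dzD (dzV ν)) z - dzS (dzV ν) z / 2) z := by
  have hE := dzV_E ν hν
  have h1 := dzS_deriv hE z
  have h2 := dzS_deriv (dzE_D hE) z
  have h3 := h1.add (((hasDerivAt_id z).mul h2).const_mul 2)
  have heq : dzF ν = dzS (dzV ν) + fun y => 2 * (((id : ℝ → ℝ) * dzS (dzD (dzV ν))) y) := by
    ext y; simp [dzF_eq ν hν]
  rw [heq]
  refine h3.congr_deriv ?_
  have := dz_ode ν hν z
  simp only [id]
  linear_combination 2 * this

lemma dzF_deriv2 (ν : ℝ) (hν : -1 < ν) (z : ℝ) :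
    HasDerivAt (fun z => (1 - 2 * ν) * dzS (dzD (dzV ν)) z - dzS (dzV ν) z / 2)
    ((1 - 2 * ν) * dzS (dzD (dzD (dzV ν))) z - dzS (dzD (dzV ν)) z / 2) z := by
  have hE := dzV_E ν hν
  exact ((dzS_deriv (dzE_D hE) z).const_mul _).sub ((dzS_deriv hE z).div_const 2)

lemma dzS_zero (ν : ℝ) : dzS (dzV ν) 0 = 1 := by
  unfold dzS
  rw [tsum_eq_single 0]
  · simp [dzV, dzPoch]
  · intro n hn; simp [hn]

lemma dz_energy_pos (ν : ℝ) (hν : -1 < ν) (a : ℝ) (ha : 0 < a) :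
    0 < 4 * ν * dzS (dzV ν) a * dzS (dzD (dzV ν)) a + 4 * a * dzS (dzD (dzV ν)) a ^ 2
      + dzS (dzV ν) a ^ 2 := by
  have hE := dzV_E ν hν
  have hν1 : 0 < ν + 1 := by linarith
  set h := dzS (dzV ν) with hh
  set h1 := dzS (dzD (dzV ν)) with hh1
  set h2 := dzS (dzD (dzD (dzV ν))) with hh2
  have d1 : ∀ z, HasDerivAt h (h1 z) z := fun z => dzS_deriv hE z
  have d2 : ∀ z, HasDerivAt h1 (h2 z) z := fun z => dzS_deriv (dzE_D hE) z
  have c1 : Continuous h := continuous_iff_continuousAt.mpr fun z => (d1 z).continuousAt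
  have c2 : Continuous h1 := continuous_iff_continuousAt.mpr fun z => (d2 z).continuousAt
  set K : ℝ → ℝ := fun z => z ^ (ν + 1) * (4 * ν * h z * h1 z + 4 * z * h1 z ^ 2 + h z ^ 2) with hK
  have cK : Continuous K := by
    have := Real.continuous_rpow_const hν1.le
    fun_prop
  have dK : ∀ z, 0 < z → HasDerivAt K (z ^ ν * h z ^ 2) z := by
    intro z hz
    have e1 := Real.hasDerivAt_rpow_const (x := z) (p := ν + 1) (Or.inl hz.ne')
    have e2 := (((d1 z).const_mul (4 * ν)).fun_mul (d2 z)).fun_add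
      ((((hasDerivAt_id z).const_mul 4).fun_mul ((d2 z).fun_pow 2))) |>.fun_add ((d1 z).fun_pow 2)
    refine (e1.fun_mul e2).congr_deriv ?_
    have ho := dz_ode ν hν z
    have ez : z ^ (ν + 1) = z ^ ν * z := by rw [Real.rpow_add_one hz.ne']
    rw [add_sub_cancel_right, ez]
    simp only [id]
    push_cast
    simp only [← hh, ← hh1, ← hh2] at ho
    have ho' : z * h2 z = -(ν + 1) * h1 z - h z / 4 := by linarith
    linear_combination (z ^ ν * (4 * ν * h z + 8 * z * h1 z)) * ho'
  have hmono : MonotoneOn K (Ici 0) := by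
    refine monotoneOn_of_deriv_nonneg (convex_Ici 0) cK.continuousOn ?_ ?_
    · intro z hz
      rw [interior_Ici] at hz
      exact (dK z hz).differentiableAt.differentiableWithinAt
    · intro z hz
      rw [interior_Ici] at hz
      have hz : 0 < z := hz
      rw [(dK z hz).deriv]; positivity
  have hK0 : K 0 = 0 := by simp [hK, Real.zero_rpow hν1.ne']
  have hKa : 0 < K a := by
    have hev : ∀ᶠ z in 𝓝 (0:ℝ), 0 < h z := by
      apply c1.continuousAt.eventually_const_lt
      rw [hh, dzS_zero]; exact one_pos
    obtain ⟨δ, hδ, hball⟩ := Metric.eventually_nhds_iff.mp hev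
    set d := min (δ / 2) a with hd
    have hd0 : 0 < d := lt_min (by positivity) ha
    have hs : StrictMonoOn K (Icc 0 d) := by
      refine strictMonoOn_of_deriv_pos (convex_Icc 0 d) cK.continuousOn ?_
      intro z hz
      rw [interior_Icc] at hz
      have hz0 : 0 < z := hz.1
      have : 0 < h z := by
        apply hball
        rw [Real.dist_eq, sub_zero, abs_of_pos hz0]
        have := min_le_left (δ / 2) a
        linarith [hz.2]
      rw [(dK z hz0).deriv]; positivity
    have h3 := hs (left_mem_Icc.mpr hd0.le) (right_mem_Icc.mpr hd0.le) hd0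
    have h4 := hmono (mem_Ici.mpr hd0.le) (mem_Ici.mpr ha.le) (min_le_right _ _)
    rw [hK0] at h3
    exact lt_of_lt_of_le h3 h4
  exact (pos_iff_pos_of_mul_pos hKa).mp (by positivity)

/-- at a positive zero of `dzF` -/
lemma dz_simple (ν : ℝ) (hν : -1 < ν) (a : ℝ) (ha : 0 < a) (hf : dzF ν a = 0) :
    dzS (dzD (dzV ν)) a ≠ 0 ∧ 0 < a + 1 - 2 * ν := by
  have h := dz_energy_pos ν hν a ha
  rw [dzF_eq ν hν] at hf
  have e : dzS (dzV ν) a = -(2 * (a * dzS (dzD (dzV ν)) a)) := by linarith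
  rw [e] at h
  set q := dzS (dzD (dzV ν)) a
  have h' : 0 < q ^ 2 * (4 * a) * (a + 1 - 2 * ν) := by nlinarith [h]
  constructor
  · intro hq; simp [hq] at h'
  · exact (pos_iff_pos_of_mul_pos h').mp
      (by
        rcases eq_or_ne q 0 with h0 | h0
        · simp [h0] at h'
        · positivity)

lemma dz_prod (b : ℕ → ℝ) (b0 : ∀ i, 0 ≤ b i) (bs : Summable b) : ∃ g g' : ℝ → ℝ,
    (∀ x, g x = ∏' i, (1 + -(b i * x))) ∧ (∀ x, HasDerivAt g (g' x) x) ∧ Continuous g' ∧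
    ∀ a, (∀ i, 1 + -(b i * a) ≠ 0) →
      HasSum (fun i => b i / (1 - b i * a)) (-(g' a / g a)) := by
  set G : ℂ → ℂ := fun z => ∏' i, (1 + -((b i : ℂ) * z)) with hG
  have hloc : ∀ R : ℝ, HasProdLocallyUniformlyOn (fun i (z : ℂ) => 1 + -((b i : ℂ) * z)) G
      (Metric.ball 0 R) := by
    intro R
    refine Summable.hasProdLocallyUniformlyOn_one_add Metric.isOpen_ball (bs.mul_right R) ?_ ?_
    · refine Eventually.of_forall fun i z hz => ?_
      have hz : ‖z‖ ≤ R := (mem_ball_zero_iff.mp hz).le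
      rw [norm_neg, norm_mul, Complex.norm_real, Real.norm_eq_abs, abs_of_nonneg (b0 i)]
      exact mul_le_mul_of_nonneg_left hz (b0 i)
    · intro i; fun_prop
  have hdiff : Differentiable ℂ G := by
    intro z
    have h1 := (hloc (‖z‖ + 1)).differentiableOn
      (Eventually.of_forall fun s => by fun_prop) Metric.isOpen_ball
    exact h1.differentiableAt (Metric.isOpen_ball.mem_nhds (by simp))
  have hsumR : ∀ x : ℝ, Summable (fun i => ‖-(b i * x)‖) := by
    intro x
    simp only [norm_neg, norm_mul]
    exact (bs.mul_right ‖x‖).congr fun i => by rw [Real.norm_eq_abs (b i), abs_of_nonneg (b0 i)]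
  have hreal : ∀ x : ℝ, G x = ((∏' i, (1 + -(b i * x)) : ℝ) : ℂ) := by
    intro x
    have hm : Multipliable (fun i => (1 + -(b i * x))) := multipliable_one_add_of_summable (hsumR x)
    have := hm.map_tprod Complex.ofRealHom Complex.continuous_ofReal
    simp only [Complex.ofRealHom_eq_coe] at this
    rw [this, hG]
    simp
  have hgx : ∀ x : ℝ, (G x).re = ∏' i, (1 + -(b i * x)) := fun x => by
    rw [hreal x, Complex.ofReal_re]
  have hder : ∀ x : ℝ, HasDerivAt (fun x : ℝ => (G x).re) (deriv G x).re x := fun x =>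
    (hdiff (x : ℂ)).hasDerivAt.real_of_complex
  refine ⟨fun x => (G x).re, fun x => (deriv G x).re, hgx, hder, ?_, ?_⟩
  · have h1 : Differentiable ℂ (deriv G) := hdiff.deriv
    exact Complex.continuous_re.comp (h1.continuous.comp Complex.continuous_ofReal)
  · intro a hne
    have hga : ∏' i, (1 + -(b i * a)) ≠ 0 := tprod_one_add_ne_zero_of_summable hne (hsumR a)
    have hsum : Summable (fun i => b i / (1 - b i * a)) := by
      have hb : Tendsto (fun i => 1 - b i * a) atTop (𝓝 (1 - 0 * a)) :=
        tendsto_const_nhds.sub (bs.tendsto_atTop_zero.mul_const a)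
      rw [zero_mul, sub_zero] at hb
      have hev : ∀ᶠ i in atTop, (1/2 : ℝ) < 1 - b i * a := hb.eventually_const_lt (by norm_num)
      refine Summable.of_norm_bounded_eventually_nat (bs.mul_left 2) ?_
      filter_upwards [hev] with i hi
      have hi0 : 0 < 1 - b i * a := by linarith
      rw [norm_div, Real.norm_eq_abs, Real.norm_eq_abs, abs_of_nonneg (b0 i), abs_of_pos hi0,
        div_le_iff₀ hi0]
      nlinarith [b0 i]
    have hlog : ∀ i, logDeriv (fun z : ℂ => 1 + -((b i : ℂ) * z)) (a : ℂ)
        = ((-(b i / (1 - b i * a)) : ℝ) : ℂ) := by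
      intro i
      have hd : HasDerivAt (fun z : ℂ => 1 + -((b i : ℂ) * z)) (-((b i : ℂ) * 1)) (a : ℂ) :=
        (((hasDerivAt_id (a : ℂ)).const_mul (b i : ℂ)).fun_neg).const_add 1
      rw [logDeriv_apply, hd.deriv]
      push_cast
      ring
    have hL := logDeriv_tprod_eq_tsum (s := Metric.ball (0:ℂ) (|a| + 1)) Metric.isOpen_ball
      (x := (a : ℂ)) (f := fun i (z : ℂ) => 1 + -((b i : ℂ) * z)) (by simp)
      (fun i => by exact_mod_cast hne i) (fun i => by fun_prop)
      (by
        simp_rw [hlog]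
        exact_mod_cast hsum.neg)
      (hloc _).multipliableLocallyUniformlyOn
      (by
        have := hreal a
        simp only [hG] at this
        rw [this]; exact_mod_cast hga)
    simp_rw [hlog] at hL
    rw [← Complex.ofReal_tsum, tsum_neg] at hL
    have hL' : deriv G a = ((∏' i, (1 + -(b i * a)) * 1 : ℝ) : ℂ)
        * ((-(∑' i, b i / (1 - b i * a)) : ℝ) : ℂ) := by
      have : G a ≠ 0 := by rw [hreal a]; exact_mod_cast hga
      rw [← hL, logDeriv_apply]
      simp only [mul_one]
      rw [← hreal a]
      change deriv G a = G a * (deriv G a / G a)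
      field_simp
    simp only [mul_one] at hL'
    rw [← Complex.ofReal_mul] at hL'
    have h6 : (deriv G a).re = (∏' i, (1 + -(b i * a))) * (-(∑' i, b i / (1 - b i * a))) := by
      rw [hL', Complex.ofReal_re]
    convert! hsum.hasSum using 1
    simp only
    rw [h6, hgx, mul_div_cancel_left₀ _ hga, neg_neg]

lemma dz_deriv_vanish (β a : ℝ) (u : ℝ → ℝ) (h : β * a = 1) (hu : ContinuousAt u a) :
    HasDerivAt (fun x => (1 - β * x) * u x) (-(β * u a)) a := by
  rw [hasDerivAt_iff_tendsto_slope]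
  have h1 : Tendsto (fun x => -(β * u x)) (𝓝[≠] a) (𝓝 (-(β * u a))) :=
    ((hu.tendsto.const_mul β).neg).mono_left nhdsWithin_le_nhds
  refine h1.congr' ?_
  filter_upwards [self_mem_nhdsWithin] with x hx
  have : x - a ≠ 0 := sub_ne_zero.mpr hx
  rw [slope_def_field, h]
  field_simp
  linear_combination (u x) * h

lemma dz_split (b : ℕ → ℝ) (b0 : ∀ i, 0 ≤ b i) (bs : Summable b) (j : ℕ) (x : ℝ) :
    ∏' i, (1 + -(b i * x)) = (1 - b j * x) * ∏' i, (1 + -(Function.update b j 0 i * x)) := by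
  have hm : Multipliable (fun i => (1 + -(Function.update b j 0 i * x))) := by
    apply multipliable_one_add_of_summable
    refine Summable.of_nonneg_of_le (fun i => norm_nonneg _) (fun i => ?_) (bs.mul_right ‖x‖)
    rw [norm_neg, norm_mul]
    gcongr
    by_cases h : i = j
    · subst h; simp [b0]
    · simp [h, abs_of_nonneg (b0 i)]
  have hs : HasProd (fun i => if i = j then 1 - b j * x else 1) (1 - b j * x) := by
    have := hasProd_ite_eq j (1 - b j * x)
    exact this
  have := (hs.mul hm.hasProd).tprod_eq
  rw [← this]
  congr 1; ext i
  by_cases h : i = j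
  · subst h; simp; ring
  · simp [h]

/-- The main consequence of the factorization at a zero. -/
lemma dz_local (ν : ℝ) (hν : -1 < ν) (b : ℕ → ℝ) (b0 : ∀ i, 0 ≤ b i) (bs : Summable b)
    (hb : ∀ z, dzF ν z = ∏' i, (1 + -(b i * z))) (j : ℕ) (a : ℝ) (ha : 0 < a)
    (hja : b j * a = 1) :
    (∀ i, i ≠ j → b i * a ≠ 1) ∧
    HasSum (fun i => Function.update b j 0 i / (1 - Function.update b j 0 i * a))
      (1 / (4 * a) * (2 * ν + 1 - (a + 2 * ν - 1) / (a - 2 * ν + 1))) := by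
  have hbj : b j ≠ 0 := by intro h; simp [h] at hja
  have u0 : ∀ i, 0 ≤ Function.update b j 0 i := by
    intro i
    by_cases h : i = j
    · subst h; simp
    · simp [h, b0 i]
  have us : Summable (Function.update b j 0) := bs.update j 0
  obtain ⟨g, g', hg, hg', hcont, hlog⟩ := dz_prod _ u0 us
  have hF : dzF ν = fun x => (1 - b j * x) * g x := by
    ext x; rw [hb, dz_split b b0 bs j, hg]
  have hFa : dzF ν a = 0 := by rw [hF]; simp [hja]
  obtain ⟨hq, hpos⟩ := dz_simple ν hν a ha hFa
  have hFd := dzF_deriv ν hν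
  have hval : ∀ x, (1 - 2 * ν) * dzS (dzD (dzV ν)) x - dzS (dzV ν) x / 2 =
      -(b j) * g x + (1 - b j * x) * g' x := by
    intro x
    have h1 := hFd x
    rw [hF] at h1
    refine h1.unique ?_
    have h2 : HasDerivAt (fun x => 1 - b j * x) (-(b j * 1)) x :=
      ((hasDerivAt_id x).const_mul (b j)).const_sub 1
    refine (h2.fun_mul (hg' x)).congr_deriv ?_
    ring
  have hval2 : (1 - 2 * ν) * dzS (dzD (dzD (dzV ν))) a - dzS (dzD (dzV ν)) a / 2 =
      -(2 * b j * g' a) := by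
    have h1 := dzF_deriv2 ν hν a
    have e : (fun z => (1 - 2 * ν) * dzS (dzD (dzV ν)) z - dzS (dzV ν) z / 2) =
      fun x => -(b j) * g x + (1 - b j * x) * g' x := funext hval
    rw [e] at h1
    refine h1.unique ?_
    refine (((hg' a).const_mul (-(b j))).fun_add
      (dz_deriv_vanish (b j) a g' hja hcont.continuousAt)).congr_deriv ?_
    ring
  have hval1 := hval a
  rw [hja, sub_self, zero_mul, add_zero] at hval1
  have hode := dz_ode ν hν a
  rw [dzF_eq ν hν] at hFa
  set q := dzS (dzD (dzV ν)) a
  set p := dzS (dzV ν) a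
  set w := dzS (dzD (dzD (dzV ν))) a
  have hp : p = -2 * a * q := by linarith
  have hga : b j * g a = -((a + 1 - 2 * ν) * q) := by rw [hp] at hval1; linarith
  have hga0 : g a ≠ 0 := by
    intro h
    rw [h, mul_zero] at hga
    have : (a + 1 - 2 * ν) * q ≠ 0 := mul_ne_zero hpos.ne' hq
    exact this (by linarith)
  have hne : ∀ i, i ≠ j → b i * a ≠ 1 := by
    intro i hij h
    apply hga0
    rw [hg, dz_split _ u0 us i]
    simp [hij, h]
  refine ⟨hne, ?_⟩
  have hs := hlog a (by
    intro i
    by_cases h : i = j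
    · subst h; simp
    · have := hne i h
      simp only [ne_eq, h, not_false_eq_true, Function.update_of_ne]
      intro h'; exact this (by linarith))
  convert! hs using 1
  have hd : a - 2 * ν + 1 ≠ 0 := by linarith
  have hw : a * w = -(ν + 1) * q + a * q / 2 := by rw [hp] at hode; linarith
  have hr : g' a / g a = (2 * (b j * g' a)) / (2 * (b j * g a)) := by
    field_simp
  have h2 : 2 * (b j * g' a) = -((1 - 2 * ν) * w - q / 2) := by linarith
  have hw' : w = (-(ν + 1) * q + a * q / 2) / a := by field_simp; linarith
  have hd2 : a + 1 - 2 * ν ≠ 0 := hpos.ne'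
  rw [hr, h2, hga, hw']
  have hd3 : a - 2 * ν + 1 = a + 1 - 2 * ν := by ring
  rw [hd3]
  field_simp
  ring

/-- Calogero-type identity for the zeros of the Dini function. -/
theorem dini_zeros_identity (ν : ℝ) (hν : -1 < ν) (α : ℕ → ℝ)
    (hαpos : ∀ n, 1 ≤ n → 0 < α n)
    (hαmono : ∀ m n, 1 ≤ m → m < n → α m < α n)
    (hαzero : ∀ n, 1 ≤ n → Dcal ν (α n) = 0)
    (hαall : ∀ x : ℝ, 0 < x → Dcal ν x = 0 → ∃ n, 1 ≤ n ∧ x = α n)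
    (k : ℕ) (hk : 1 ≤ k) (hne : α k ^ 2 ≠ 2 * ν - 1) :
    HasSum (fun n : {n : ℕ // 1 ≤ n ∧ n ≠ k} => 1 / (α n ^ 2 - α k ^ 2))
      (1 / (4 * α k ^ 2) *
        (2 * ν + 1 - (α k ^ 2 + 2 * ν - 1) / (α k ^ 2 - 2 * ν + 1))) := by
  obtain ⟨b, b0, bs, hb⟩ := dzF_factor ν hν
  have hzero : ∀ z, dzF ν z = 0 → ∃ j, b j * z = 1 := by
    intro z hz
    by_contra hcon
    push Not at hcon
    rw [hb] at hz
    refine tprod_one_add_ne_zero_of_summable (f := fun i => -(b i * z)) ?_ ?_ hz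
    · intro i h; exact hcon i (by linarith)
    · simp only [norm_neg, norm_mul]
      exact (bs.mul_right ‖z‖).congr fun i => by
        rw [Real.norm_eq_abs (b i), abs_of_nonneg (b0 i)]
  have hzero' : ∀ j z, b j * z = 1 → dzF ν z = 0 := by
    intro j z h
    rw [hb, dz_split b b0 bs j, h]; simp
  have hj : ∀ n, ∃ j, 1 ≤ n → b j * α n ^ 2 = 1 := by
    intro n
    by_cases hn : 1 ≤ n
    · obtain ⟨j, hj⟩ := hzero (α n ^ 2) (by rw [← dz_Dcal ν hν]; exact hαzero n hn)
      exact ⟨j, fun _ => hj⟩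
    · exact ⟨0, fun h => absurd h hn⟩
  choose e he using hj
  have hinj : ∀ m n, 1 ≤ m → 1 ≤ n → α m = α n → m = n := by
    intro m n hm hn h
    rcases lt_trichotomy m n with h' | h' | h'
    · exact absurd h (hαmono m n hm h').ne
    · exact h'
    · exact absurd h (hαmono n m hn h').ne'
  have heinj : ∀ m n, 1 ≤ m → 1 ≤ n → e m = e n → m = n := by
    intro m n hm hn h
    apply hinj m n hm hn
    have h1 := he m hm
    have h2 := he n hn
    rw [h] at h1
    have hb0 : b (e n) ≠ 0 := by intro h; simp [h] at h2
    have h3 : α m ^ 2 = α n ^ 2 := mul_left_cancel₀ hb0 (h1.trans h2.symm)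
    exact (pow_left_inj₀ (hαpos m hm).le (hαpos n hn).le two_ne_zero).mp h3
  have hak : 0 < α k ^ 2 := pow_pos (hαpos k hk) 2
  obtain ⟨_, hsum⟩ := dz_local ν hν b b0 bs hb (e k) (α k ^ 2) hak (he k hk)
  have hinj' : Function.Injective (fun n : {n : ℕ // 1 ≤ n ∧ n ≠ k} => e n) := by
    intro m n h
    exact Subtype.ext (heinj m n m.2.1 n.2.1 h)
  rw [← hinj'.hasSum_iff] at hsum
  · convert! hsum using 1
    ext n
    have hn := he n n.2.1
    have hne1 : e n ≠ e k := fun h => n.2.2 (heinj n k n.2.1 hk h)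
    have hpn := pow_pos (hαpos n n.2.1) 2
    have hαn0 : α n ≠ 0 := (hαpos n n.2.1).ne'
    have hbn : b (e n) = 1 / α n ^ 2 := by rw [eq_div_iff hpn.ne']; exact hn
    have hd : α n ^ 2 - α k ^ 2 ≠ 0 := by
      intro h
      apply n.2.2
      apply hinj n k n.2.1 hk
      exact (pow_left_inj₀ (hαpos n n.2.1).le (hαpos k hk).le two_ne_zero).mp (by linarith)
    simp only [Function.comp, ne_eq, hne1, not_false_eq_true, Function.update_of_ne, hbn]
    have hd' : 1 - 1 / α n ^ 2 * α k ^ 2 = (α n ^ 2 - α k ^ 2) / α n ^ 2 := by field_simp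
    rw [hd']
    field_simp
  · intro i hi
    by_cases hik : i = e k
    · subst hik; simp
    by_cases hbi : b i = 0
    · simp [hik, hbi]
    exfalso
    have hbpos : 0 < b i := lt_of_le_of_ne (b0 i) (Ne.symm hbi)
    have hsq : √(1 / b i) ^ 2 = 1 / b i := Real.sq_sqrt (by positivity)
    have hz : dzF ν (1 / b i) = 0 := hzero' i _ (by field_simp)
    obtain ⟨n, hn, hαn⟩ := hαall (√(1 / b i)) (Real.sqrt_pos.mpr (by positivity))
      (by rw [dz_Dcal ν hν, hsq, hz])
    have hbn : b i * α n ^ 2 = 1 := by rw [← hαn, hsq]; field_simp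
    have hin : i = e n := by
      by_contra hne'
      exact (dz_local ν hν b b0 bs hb (e n) (α n ^ 2) (pow_pos (hαpos n hn) 2) (he n hn)).1 i
        hne' hbn
    have hnk : n ≠ k := by rintro rfl; exact hik hin
    exact hi ⟨⟨n, hn, hnk⟩, hin.symm⟩
end

section
/- Let ν > -1 and m ≥ 1. Then the Euler–Rayleigh inequalities hold: (η_{2m}(ν))^{-1/m} < α_{ν,1}² < η_{2m}(ν)/η_{2m+2}(ν) and (ζ_{4m}(ν))^{-1/m} < γ_{ν,1}⁴ < ζ_{4m}(ν)/ζ_{4m+4}(ν). -/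
open Real Set

theorem euler_rayleigh_aux (a : ℕ → ℝ) (k : ℕ) (hk : 1 ≤ k)
    (hpos : ∀ n, 1 ≤ n → 0 < a n)
    (hmono : ∀ m n, 1 ≤ m → m < n → a m < a n)
    (hsum : ∀ m : ℕ, 1 ≤ m → Summable (fun n : ℕ => 1 / a (n + 1) ^ (k * m)))
    (m : ℕ) (hm : 1 ≤ m) :
    (∑' n : ℕ, 1 / a (n + 1) ^ (k * m)) ^ (-(1 : ℝ) / m) < a 1 ^ k ∧
      a 1 ^ k < (∑' n : ℕ, 1 / a (n + 1) ^ (k * m)) /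
        (∑' n : ℕ, 1 / a (n + 1) ^ (k * m + k)) := by
  have h1 : 0 < a 1 := hpos 1 le_rfl
  have hp : ∀ n, 0 < a (n + 1) := fun n => hpos _ (by omega)
  have hS := hsum m hm
  have hS' : Summable (fun n : ℕ => 1 / a (n + 1) ^ (k * m + k)) := hsum (m + 1) (by omega)
  have hc : 0 < a 1 ^ k := by positivity
  have hm0 : (m : ℝ) ≠ 0 := by exact_mod_cast (by omega : m ≠ 0)
  constructor
  · have hlt : 1 / a 1 ^ (k * m) < ∑' n : ℕ, 1 / a (n + 1) ^ (k * m) := by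
      have h2 := hS.sum_le_tsum (Finset.range 2) (fun n _ => by have := hp n; positivity)
      rw [Finset.sum_range_succ, Finset.sum_range_one] at h2
      have h3 : 0 < 1 / a (1 + 1) ^ (k * m) := by have := hp 1; positivity
      simp only [zero_add] at h2
      linarith
    have h4 : (1 / a 1 ^ (k * m)) ^ (-(1 : ℝ) / m) = a 1 ^ k := by
      rw [pow_mul, one_div, ← Real.rpow_natCast (a 1 ^ k) m, ← Real.rpow_neg hc.le,
        ← Real.rpow_mul hc.le]
      have : -(m : ℝ) * (-1 / m) = 1 := by field_simp
      rw [this, Real.rpow_one]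
    rw [← h4]
    apply Real.rpow_lt_rpow_of_neg (by positivity) hlt
    have : (0 : ℝ) < m := by exact_mod_cast hm
    exact div_neg_of_neg_of_pos (by norm_num) this
  · have hS'pos : 0 < ∑' n : ℕ, 1 / a (n + 1) ^ (k * m + k) :=
      hS'.tsum_pos (fun n => by have := hp n; positivity) 0 (by have := hp 0; positivity)
    rw [lt_div_iff₀ hS'pos, ← tsum_mul_left]
    have key : ∀ n, 1 / a (n + 1) ^ (k * m) = a (n + 1) ^ k * (1 / a (n + 1) ^ (k * m + k)) := by
      intro n
      have := hp n
      rw [pow_add]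
      field_simp
    refine Summable.tsum_lt_tsum (i := 1) ?_ ?_ (hS'.mul_left _) hS
    · intro n
      beta_reduce
      rw [key n]
      have h0 := hp n
      have hle : a 1 ≤ a (n + 1) := by
        rcases Nat.eq_zero_or_pos n with h | h
        · subst h; exact le_rfl
        · exact (hmono 1 (n + 1) le_rfl (by omega)).le
      gcongr
    · rw [key 1]
      have h0 := hp 1
      have hl : a 1 < a (1 + 1) := hmono 1 _ le_rfl (by omega)
      exact mul_lt_mul_of_pos_right (pow_lt_pow_left₀ hl h1.le (by omega)) (by positivity)

/-- Euler–Rayleigh inequalities for the zeros of the Dini function and of the cross-product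
of Bessel functions. -/
theorem euler_rayleigh_inequalities (ν : ℝ) (hν : -1 < ν) (α γ : ℕ → ℝ)
    (hαpos : ∀ n, 1 ≤ n → 0 < α n)
    (hαmono : ∀ m n, 1 ≤ m → m < n → α m < α n)
    (hαzero : ∀ n, 1 ≤ n → Dcal ν (α n) = 0)
    (hαall : ∀ x : ℝ, 0 < x → Dcal ν x = 0 → ∃ n, 1 ≤ n ∧ x = α n)
    (hγpos : ∀ n, 1 ≤ n → 0 < γ n)
    (hγmono : ∀ m n, 1 ≤ m → m < n → γ m < γ n)
    (hγzero : ∀ n, 1 ≤ n → Wcal ν (γ n) = 0)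
    (hγall : ∀ x : ℝ, 0 < x → Wcal ν x = 0 → ∃ n, 1 ≤ n ∧ x = γ n)
    (hηsum : ∀ m : ℕ, 1 ≤ m → Summable (fun n : ℕ => 1 / α (n + 1) ^ (2 * m)))
    (hζsum : ∀ m : ℕ, 1 ≤ m → Summable (fun n : ℕ => 1 / γ (n + 1) ^ (4 * m)))
    (m : ℕ) (hm : 1 ≤ m) :
    ((∑' n : ℕ, 1 / α (n + 1) ^ (2 * m)) ^ (-(1 : ℝ) / m) < α 1 ^ 2 ∧
      α 1 ^ 2 < (∑' n : ℕ, 1 / α (n + 1) ^ (2 * m)) /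
        (∑' n : ℕ, 1 / α (n + 1) ^ (2 * m + 2))) ∧
    ((∑' n : ℕ, 1 / γ (n + 1) ^ (4 * m)) ^ (-(1 : ℝ) / m) < γ 1 ^ 4 ∧
      γ 1 ^ 4 < (∑' n : ℕ, 1 / γ (n + 1) ^ (4 * m)) /
        (∑' n : ℕ, 1 / γ (n + 1) ^ (4 * m + 4))) := by
  exact ⟨euler_rayleigh_aux α 2 (by norm_num) hαpos hαmono hηsum m hm,
    euler_rayleigh_aux γ 4 (by norm_num) hγpos hγmono hζsum m hm⟩
end
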